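/- arXiv:1203.5244 — 2 statements merged into one kernel-verified Lean document; each statement's English description precedes it below -/
import Mathlib

section
/- Let $m\geq2$, $q\geq3$, $2\leq b\leq q-1$. The second weight codewords of $R_q(b,m)$, i.e., the codewords with $|f|=(q-b+1)(q-1)q^{m-2}$, are exactly those whose support $S$ is either (A) the union of $q-b+1$ parallel affine hyperplanes minus their intersection with a non-parallel hyperplane, or (B) the union of $q-b+1$ affine hyperplanes containing a common affine subspace of codimension 2, minus that subspace. -/
set_option linter.unusedSectionVars false

inductive PD (F : Type) [Field F] {V : Type} [AddCommGroup V] [Module F V] : ℕ → (V → F) → Prop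
  | const (n : ℕ) (c : F) : PD F n (fun _ => c)
  | add {n : ℕ} {f g : V → F} : PD F n f → PD F n g → PD F n (fun x => f x + g x)
  | mul {n : ℕ} {f : V → F} (l : V →ₗ[F] F) : PD F n f → PD F (n+1) (fun x => l x * f x)

namespace PD
variable {F : Type} [Field F] {V W : Type} [AddCommGroup V] [Module F V] [AddCommGroup W] [Module F W]

theorem mono {n k : ℕ} {f : V → F} (h : PD F n f) (hk : n ≤ k) : PD F k f := by
  induction h generalizing k with
  | const n c => exact PD.const k c
  | add _ _ h1 h2 => exact PD.add (h1 hk) (h2 hk)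
  | mul l _ h1 =>
    obtain ⟨k, rfl⟩ : ∃ j, k = j + 1 := ⟨k - 1, by omega⟩
    exact PD.mul l (h1 (by omega))

theorem congr {n : ℕ} {f g : V → F} (h : PD F n f) (e : ∀ x, g x = f x) : PD F n g := by
  rw [show g = f from funext e]; exact h

theorem zero (n : ℕ) : PD F n (0 : V → F) := PD.const n 0

theorem smul {n : ℕ} {f : V → F} (c : F) (h : PD F n f) : PD F n (fun x => c * f x) := by
  induction h with
  | const n d => exact PD.const n (c*d)
  | add _ _ h1 h2 => exact (PD.add h1 h2).congr (fun x => by ring)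
  | mul l _ h1 => exact (PD.mul l h1).congr (fun x => by ring)

theorem mul' {n k : ℕ} {f g : V → F} (hf : PD F n f) (hg : PD F k g) :
    PD F (n + k) (fun x => f x * g x) := by
  induction hf with
  | const n c => exact (hg.smul c).mono (by omega)
  | add _ _ h1 h2 => exact (PD.add h1 h2).congr (fun x => by ring)
  | mul l _ h1 =>
    exact ((PD.mul l h1).congr (fun x => by ring)).mono (by omega)

theorem neg {n : ℕ} {f : V → F} (h : PD F n f) : PD F n (fun x => - f x) :=
  (h.smul (-1)).congr (fun x => by ring)

theorem sub {n : ℕ} {f g : V → F} (hf : PD F n f) (hg : PD F n g) :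
    PD F n (fun x => f x - g x) := (hf.add hg.neg).congr (fun x => by ring)

theorem lin (l : V →ₗ[F] F) : PD F 1 (fun x => l x) :=
  (PD.mul l (PD.const 0 1)).congr (fun x => by ring)

theorem aff (l : V →ₗ[F] F) (c : F) : PD F 1 (fun x => l x - c) := (lin l).sub (PD.const 1 c)

theorem comp {n : ℕ} {f : V → F} (hf : PD F n f) (φ : W →ₗ[F] V) (v : V) :
    PD F n (fun x => f (v + φ x)) := by
  induction hf with
  | const n c => exact PD.const n c
  | add _ _ h1 h2 => exact h1.add h2
  | @mul n f l _ h1 =>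
    refine ((PD.mul (l.comp φ) h1).add ((h1.smul (l v)).mono (Nat.le_succ _))).congr (fun x => ?_)
    simp; ring

theorem translate {n : ℕ} {f : V → F} (hf : PD F n f) (v : V) :
    PD F n (fun x => f (x + v)) :=
  (hf.comp LinearMap.id v).congr (fun x => by simp [add_comm])

theorem sum {n : ℕ} {ι : Type*} (s : Finset ι) {f : ι → V → F} (h : ∀ i ∈ s, PD F n (f i)) :
    PD F n (fun x => ∑ i ∈ s, f i x) := by
  classical
  induction s using Finset.induction_on with
  | empty => exact (PD.const n 0).congr (by simp)
  | insert a s ha ih =>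
    refine ((h a (by simp)).add (ih (fun i hi => h i (by simp [hi])))).congr (fun x => ?_)
    rw [Finset.sum_insert ha]

theorem pow_lin (l : V →ₗ[F] F) (k : ℕ) : PD F k (fun x => l x ^ k) := by
  induction k with
  | zero => exact (PD.const 0 1).congr (by simp)
  | succ k ih => exact (PD.mul l ih).congr (fun x => by ring)

theorem eq_const {f : V → F} (h : PD F 0 f) : ∃ c, ∀ x, f x = c := by
  generalize hn : (0:ℕ) = n at h
  induction h with
  | const n c => exact ⟨c, fun _ => rfl⟩
  | add _ _ h1 h2 =>
    obtain ⟨a, ha⟩ := h1 hn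
    obtain ⟨b, hb⟩ := h2 hn
    exact ⟨a + b, fun x => by beta_reduce; rw [ha, hb]⟩
  | mul => omega

theorem eq_aff {f : V → F} (h : PD F 1 f) : ∃ (l : V →ₗ[F] F) (c : F), ∀ x, f x = l x + c := by
  generalize hn : (1:ℕ) = n at h
  induction h with
  | const n c => exact ⟨0, c, fun _ => by simp⟩
  | add _ _ h1 h2 =>
    obtain ⟨l, a, ha⟩ := h1 hn
    obtain ⟨l', b, hb⟩ := h2 hn
    exact ⟨l + l', a + b, fun x => by beta_reduce; rw [ha, hb]; simp; ring⟩
  | @mul n f l hf _ =>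
    obtain rfl : n = 0 := by omega
    obtain ⟨c, hc⟩ := eq_const hf
    exact ⟨c • l, 0, fun x => by beta_reduce; rw [hc]; simp; ring⟩
end PD

section TDsec
open Polynomial
variable {F : Type} [Field F] {V : Type} [AddCommGroup V] [Module F V]

def TD (n : ℕ) (P : Polynomial (V → F)) : Prop :=
  ∀ k, (k ≤ n → PD F (n - k) (P.coeff k)) ∧ (n < k → P.coeff k = 0)

noncomputable def ev (x : V) : Polynomial (V → F) →+* Polynomial F :=
  Polynomial.mapRingHom (Pi.evalRingHom (fun _ => F) x)

theorem ev_coeff (x : V) (P : Polynomial (V → F)) (k : ℕ) : (ev x P).coeff k = P.coeff k x := by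
  simp [ev]

theorem ev_X (x : V) : ev x (X : Polynomial (V → F)) = X := by simp [ev]
theorem ev_C (x : V) (c : V → F) : ev x (C c) = C (c x) := by simp [ev]

theorem TD.zero (n : ℕ) : TD n (0 : Polynomial (V → F)) := fun k =>
  ⟨fun _ => by simpa using PD.zero _, fun _ => by simp⟩

theorem TD.add {n : ℕ} {P Q : Polynomial (V → F)} (hP : TD n P) (hQ : TD n Q) : TD n (P + Q) :=
  fun k => ⟨fun h => by rw [coeff_add]; exact ((hP k).1 h).add ((hQ k).1 h),
    fun h => by rw [coeff_add, (hP k).2 h, (hQ k).2 h, add_zero]⟩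

theorem TD.neg {n : ℕ} {P : Polynomial (V → F)} (hP : TD n P) : TD n (-P) :=
  fun k => ⟨fun h => by rw [coeff_neg]; exact ((hP k).1 h).neg,
    fun h => by rw [coeff_neg, (hP k).2 h, neg_zero]⟩

theorem TD.sub {n : ℕ} {P Q : Polynomial (V → F)} (hP : TD n P) (hQ : TD n Q) : TD n (P - Q) := by
  rw [sub_eq_add_neg]; exact hP.add hQ.neg

theorem TD.mul {n m : ℕ} {P Q : Polynomial (V → F)} (hP : TD n P) (hQ : TD m Q) :
    TD (n + m) (P * Q) := by
  intro k
  constructor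
  · intro hk
    rw [coeff_mul]
    have : PD F (n + m - k) (fun x => ∑ i ∈ Finset.HasAntidiagonal.antidiagonal k, (P.coeff i.1 * Q.coeff i.2) x) := by
      apply PD.sum
      intro i hi
      rw [Finset.HasAntidiagonal.mem_antidiagonal] at hi
      by_cases h1 : i.1 ≤ n
      · by_cases h2 : i.2 ≤ m
        · exact (((hP _).1 h1).mul' ((hQ _).1 h2)).mono (by omega)
        · rw [(hQ _).2 (by omega), mul_zero]; exact PD.zero _
      · rw [(hP _).2 (by omega), zero_mul]; exact PD.zero _
    exact this.congr (fun x => by simp)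
  · intro hk
    rw [coeff_mul]
    apply Finset.sum_eq_zero
    intro i hi
    rw [Finset.HasAntidiagonal.mem_antidiagonal] at hi
    by_cases h1 : i.1 ≤ n
    · rw [(hQ i.2).2 (by omega), mul_zero]
    · rw [(hP i.1).2 (by omega), zero_mul]

theorem TD.CX {n j : ℕ} {c : V → F} (hc : PD F (n - j) c) (hj : j ≤ n) :
    TD n (C c * X ^ j) := by
  intro k
  rw [coeff_C_mul_X_pow]
  constructor
  · intro hk
    split_ifs with h
    · subst h; exact hc
    · exact PD.zero _
  · intro hk
    rw [if_neg (by omega)]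

theorem TD.X' : TD 1 (X : Polynomial (V → F)) := by
  have := TD.CX (n := 1) (j := 1) (c := (1 : V → F)) (PD.const _ 1) le_rfl
  simpa using this

theorem TD.one (n : ℕ) : TD n (1 : Polynomial (V → F)) := by
  have := TD.CX (n := n) (j := 0) (c := (1 : V → F)) (PD.const _ 1) (Nat.zero_le _)
  simpa using this

theorem TD.pow {n : ℕ} {P : Polynomial (V → F)} (hP : TD n P) (t : ℕ) : TD (n * t) (P ^ t) := by
  induction t with
  | zero => simpa using TD.one 0
  | succ t ih => rw [pow_succ]; exact ih.mul hP

theorem TD.mono {n k : ℕ} {P : Polynomial (V → F)} (hP : TD n P) (h : n ≤ k) : TD k P := by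
  have := hP.mul (TD.one (V := V) (F := F) (k - n))
  rw [mul_one] at this
  rwa [Nat.add_sub_cancel' h] at this

theorem TD.prod {ι : Type*} (s : Finset ι) {P : ι → Polynomial (V → F)} (h : ∀ i ∈ s, TD 1 (P i)) :
    TD s.card (∏ i ∈ s, P i) := by
  classical
  induction s using Finset.induction_on with
  | empty => simpa using TD.one 0
  | insert a s ha ih =>
    rw [Finset.prod_insert ha, Finset.card_insert_of_notMem ha, add_comm]
    exact (h a (by simp)).mul (ih (fun i hi => h i (by simp [hi])))

theorem TD.div {n d : ℕ} {D : Polynomial (V → F)} (hD : TD d D) (hD1 : D.coeff d = 1) (hdn : d ≤ n)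
    (N : ℕ) : ∀ P : Polynomial (V → F), TD n P → (∀ k, N ≤ k → P.coeff k = 0) →
    ∃ Q R, P = D * Q + R ∧ TD (n - d) Q ∧ TD n R ∧ ∀ k, d ≤ k → R.coeff k = 0 := by
  induction N with
  | zero =>
    intro P hP h
    exact ⟨0, P, by simp, TD.zero _, hP, fun k _ => h k (Nat.zero_le _)⟩
  | succ M ih =>
    intro P hP h
    by_cases hM : M < d
    · exact ⟨0, P, by simp, TD.zero _, hP, fun k hk => h k (by omega)⟩
    push Not at hM
    have hT : TD (n - d) (C (P.coeff M) * X ^ (M - d)) := by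
      by_cases hMn : M ≤ n
      · refine TD.CX ?_ (by omega)
        rw [show n - d - (M - d) = n - M by omega]
        exact (hP M).1 hMn
      · rw [(hP M).2 (by omega)]; simpa using TD.zero _
    obtain ⟨Q, R, e, hQ, hR, hk⟩ := ih (P - D * (C (P.coeff M) * X ^ (M - d))) (by
        refine hP.sub ?_
        have := hD.mul hT
        rwa [Nat.add_sub_cancel' hdn] at this) (by
        intro k hk
        rw [coeff_sub, mul_comm (C _), ← mul_assoc, coeff_mul_C, coeff_mul_X_pow', if_pos (by omega)]
        rcases hk.eq_or_lt with rfl | hk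
        · rw [show M - (M - d) = d by omega, hD1, one_mul, sub_self]
        · rw [h k (by omega), (hD (k - (M - d))).2 (by omega)]; simp)
    refine ⟨Q + C (P.coeff M) * X ^ (M - d), R, ?_, hQ.add hT, hR, hk⟩
    linear_combination e

theorem PD.taylor {n : ℕ} {f : V → F} (hf : PD F n f) (v : V) :
    ∃ P : Polynomial (V → F), TD n P ∧ ∀ x t, f (x + t • v) = (ev x P).eval t := by
  induction hf with
  | const n c =>
    refine ⟨C (fun _ => c), ?_, fun x t => by simp [ev_C]⟩
    have := TD.CX (n := n) (j := 0) (c := (fun _ => c : V → F)) (PD.const _ c) (Nat.zero_le _)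
    simpa using this
  | add _ _ h1 h2 =>
    obtain ⟨P, hP, eP⟩ := h1
    obtain ⟨Q, hQ, eQ⟩ := h2
    exact ⟨P + Q, hP.add hQ, fun x t => by beta_reduce; rw [eP, eQ, map_add, eval_add]⟩
  | @mul n f l _ h1 =>
    obtain ⟨P, hP, eP⟩ := h1
    refine ⟨(C (fun x => l x) + C (fun _ => l v) * X ^ 1) * P, ?_, fun x t => ?_⟩
    · rw [add_comm n 1]
      refine TD.mul (TD.add ?_ (TD.CX (PD.const _ _) le_rfl)) hP
      have := TD.CX (n := 1) (j := 0) (c := (fun x => l x : V → F)) (PD.lin l) (Nat.zero_le _)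
      simpa using this
    · beta_reduce; rw [eP]; simp [ev_C, ev_X]; left; ring

/-- substitution back into a function -/
theorem TD.subst {n : ℕ} {P : Polynomial (V → F)} (hP : TD n P) (φ : V →ₗ[F] V) (w : V)
    (χ : V →ₗ[F] F) (c : F) : PD F n (fun x => (ev (w + φ x) P).eval (χ x - c)) := by
  have h1 : ∀ k, PD F k (fun x => (χ x - c)^k) := by
    intro k
    induction k with
    | zero => exact (PD.const 0 1).congr (by simp)
    | succ k ih => exact (ih.mul' (PD.aff χ c)).congr (fun x => by ring)
  have h2 : PD F n (fun x => ∑ k ∈ Finset.range (n+1), P.coeff k (w + φ x) * (χ x - c)^k) := by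
    apply PD.sum
    intro k hk
    rw [Finset.mem_range] at hk
    exact ((((hP k).1 (by omega)).comp φ w).mul' (h1 k)).mono (by omega)
  refine h2.congr (fun x => ?_)
  have hd : (ev (w + φ x) P).natDegree < n + 1 := by
    rw [Nat.lt_succ_iff, natDegree_le_iff_coeff_eq_zero]
    intro k hk
    rw [ev_coeff, (hP k).2 hk]; rfl
  rw [eval_eq_sum_range' hd]
  simp [ev_coeff]

end TDsec

set_option linter.unusedSectionVars false
section A2
open Polynomial
variable {F : Type} [Field F] {V : Type} [AddCommGroup V] [Module F V]

theorem TD.natDegree_ev {n : ℕ} {P : Polynomial (V → F)} (hP : TD n P) (x : V) :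
    (ev x P).natDegree ≤ n := by
  rw [natDegree_le_iff_coeff_eq_zero]
  intro k hk
  rw [ev_coeff, (hP k).2 hk]; rfl

theorem PD.roots {n : ℕ} {f : V → F} (hf : PD F n f) (x v : V) (T : Finset F) (hT : n < T.card)
    (h : ∀ t ∈ T, f (x + t • v) = 0) (t : F) : f (x + t • v) = 0 := by
  obtain ⟨P, hP, e⟩ := hf.taylor v
  have : ev x P = 0 := by
    apply Polynomial.eq_zero_of_natDegree_lt_card_of_eval_eq_zero' _ T
    · intro t ht; rw [← e]; exact h t ht
    · exact lt_of_le_of_lt (hP.natDegree_ev x) hT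
  rw [e, this]; simp

theorem exists_one (y : V →ₗ[F] F) (hy : y ≠ 0) : ∃ v, y v = 1 := by
  by_contra hc
  apply hy
  ext v
  by_contra h
  exact hc ⟨(y v)⁻¹ • v, by simp at h; simp [h]⟩

theorem exists_val (y : V →ₗ[F] F) (hy : y ≠ 0) (a : F) : ∃ v, y v = a := by
  obtain ⟨v, hv⟩ := exists_one y hy
  exact ⟨a • v, by simp [hv]⟩

theorem PD.divide {n : ℕ} {f : V → F} (hf : PD F (n+1) f) (y : V →ₗ[F] F) (hy : y ≠ 0) (a : F)
    (h : ∀ x, y x = a → f x = 0) : ∃ g, PD F n g ∧ ∀ x, f x = (y x - a) * g x := by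
  obtain ⟨v, hv⟩ := exists_one y hy
  obtain ⟨P, hP, e⟩ := hf.taylor v
  have hd : TD n P.divX := by
    intro k
    rw [coeff_divX]
    exact ⟨fun hk => by have := (hP (k+1)).1 (by omega); rwa [Nat.add_sub_add_right] at this,
      fun hk => (hP (k+1)).2 (by omega)⟩
  let φ : V →ₗ[F] V := LinearMap.id - y.smulRight v
  have hφ : ∀ x, φ x = x - y x • v := fun x => by simp [φ]
  refine ⟨_, hd.subst φ (a • v) y a, fun x => ?_⟩
  beta_reduce
  set x0 := a • v + φ x with hx0
  have hx : x = x0 + (y x - a) • v := by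
    rw [hx0, hφ, sub_smul]; abel
  have hy0 : y x0 = a := by rw [hx0, hφ]; simp [hv]
  have h0 : P.coeff 0 x0 = 0 := by
    have := e x0 0
    rw [zero_smul, add_zero, h x0 hy0, ← coeff_zero_eq_eval_zero, ev_coeff] at this
    exact this.symm
  calc f x = f (x0 + (y x - a) • v) := by rw [← hx]
    _ = _ := by
      rw [e]
      conv_lhs => rw [← divX_mul_X_add P]
      rw [map_add, map_mul, ev_C, ev_X, h0, eval_add, eval_mul, eval_X, eval_C, add_zero, mul_comm]

theorem PD.fac [Fintype F] {ι : Type} (I : Finset ι) (N : ι → V →ₗ[F] F)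
    (ν : ι → F) : ∀ (n : ℕ) (f : V → F), PD F n f → n ≤ Fintype.card F - 1 → (∀ i ∈ I, N i ≠ 0) →
    (∀ i ∈ I, ∀ j ∈ I, i ≠ j → ∃ x, N j x = ν j ∧ N i x ≠ ν i) →
    (∀ i ∈ I, ∀ x, N i x = ν i → f x = 0) →
    (∀ x, f x = 0) ∨ (I.card ≤ n ∧ ∃ g, PD F (n - I.card) g ∧ ∀ x, f x = (∏ i ∈ I, (N i x - ν i)) * g x) := by
  classical
  induction I using Finset.induction_on with
  | empty =>
    intro n f hf _ _ _ _
    exact Or.inr ⟨by simp, f, by simpa using hf, by simp⟩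
  | insert i0 I hi ih =>
    intro n f hf hn hN hdis hv
    have hN0 := hN i0 (by simp)
    rcases n with _ | n
    · left
      obtain ⟨c, hc⟩ := hf.eq_const
      obtain ⟨x, hx⟩ := exists_val (N i0) hN0 (ν i0)
      have := hv i0 (by simp) x hx
      intro z; rw [hc, ← hc x, this]
    obtain ⟨f1, hf1, e1⟩ := hf.divide (N i0) hN0 (ν i0) (hv i0 (by simp))
    have key : ∀ i ∈ I, ∀ x, N i x = ν i → f1 x = 0 := by
      intro j hj p hp
      by_cases hp0 : N i0 p = ν i0
      · obtain ⟨p', h1, h2⟩ := hdis i0 (by simp) j (by simp [hj]) (by rintro rfl; exact hi hj)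
        have := hf1.roots p (p' - p) (Finset.univ.erase 0) (by
          rw [Finset.card_erase_of_mem (Finset.mem_univ _), Finset.card_univ]; omega) (by
          intro t ht
          have ht0 : t ≠ 0 := by simpa using ht
          have hz : f (p + t • (p' - p)) = 0 := hv j (by simp [hj]) _ (by simp [hp, h1])
          rw [e1] at hz
          refine (mul_eq_zero.1 hz).resolve_left ?_
          simp only [map_add, map_smul, map_sub, hp0, smul_eq_mul]
          rw [add_sub_cancel_left]
          exact mul_ne_zero ht0 (sub_ne_zero.2 h2)) 0
        simpa using this
      · have hz := hv j (by simp [hj]) p hp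
        rw [e1] at hz
        exact (mul_eq_zero.1 hz).resolve_left (sub_ne_zero.2 hp0)
    rcases ih n f1 hf1 (by omega) (fun i h => hN i (by simp [h]))
      (fun i h j h' => hdis i (by simp [h]) j (by simp [h'])) key with h | ⟨h, g, hg, eg⟩
    · left; intro x; rw [e1, h, mul_zero]
    · right
      rw [Finset.card_insert_of_notMem hi]
      refine ⟨by omega, g, ?_, fun x => ?_⟩
      · rwa [Nat.add_sub_add_right]
      · rw [e1, eg, Finset.prod_insert hi]; ring

theorem PD.of_mv {m : ℕ} (P : MvPolynomial (Fin m) F) :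
    PD F P.totalDegree (fun x : Fin m → F => MvPolynomial.eval x P) := by
  have h : PD F P.totalDegree (fun x : Fin m → F => ∑ d ∈ P.support, P.coeff d * ∏ i, x i ^ d i) := by
    apply PD.sum
    intro d hd
    have hd' := MvPolynomial.le_totalDegree hd
    refine PD.mono ?_ hd'
    apply PD.smul
    rw [Finsupp.sum_fintype _ _ (by simp)]
    have : ∀ s : Finset (Fin m), PD F (∑ i ∈ s, d i) (fun x : Fin m → F => ∏ i ∈ s, x i ^ d i) := by
      intro s
      induction s using Finset.induction_on with
      | empty => exact (PD.const _ 1).congr (by simp)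
      | insert a s ha ih =>
        rw [Finset.sum_insert ha]
        refine ((PD.pow_lin (LinearMap.proj a) (d a)).mul' ih).congr (fun x => ?_)
        rw [Finset.prod_insert ha]; rfl
    exact this _
  exact h.congr (fun x => MvPolynomial.eval_eq' x P)

/-- remainder vanishing off a hyperplane is affine on it -/
theorem PD.affOn [Fintype F] (y : V →ₗ[F] F) (hy : y ≠ 0) (a : F) {r : V → F}
    (hr : PD F (Fintype.card F) r) (h : ∀ x, y x ≠ a → r x = 0) :
    ∃ A, PD F 1 A ∧ ∀ x, y x = a → r x = A x := by
  classical
  obtain ⟨v, hv⟩ := exists_one y hy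
  obtain ⟨P, hP, e⟩ := hr.taylor v
  set q := Fintype.card F with hq
  have hq2 : 2 ≤ q := Fintype.one_lt_card
  refine ⟨fun x => ∑ k ∈ Finset.range (q+1), (∑ s : F, s ^ k) * P.coeff k x, ?_, ?_⟩
  · apply PD.sum
    intro k hk
    rw [Finset.mem_range] at hk
    by_cases hk' : k < q - 1
    · rw [FiniteField.sum_pow_lt_card_sub_one F k hk']
      exact (PD.const _ 0).congr (by simp)
    · exact (((hP k).1 (by omega)).smul _).mono (by omega)
  · intro x hx
    have h1 : r x = ∑ s : F, r (x + s • v) := by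
      rw [Finset.sum_eq_single 0]
      · simp
      · intro s _ hs
        apply h
        simp [hx, hv, hs]
      · simp
    rw [h1]
    simp_rw [Finset.sum_mul]
    rw [Finset.sum_comm]
    refine Finset.sum_congr rfl (fun s _ => ?_)
    rw [e, eval_eq_sum_range' (Nat.lt_succ_of_le (hP.natDegree_ev x))]
    refine Finset.sum_congr rfl (fun k _ => ?_)
    rw [ev_coeff, mul_comm]
end A2

set_option linter.unusedSectionVars false
section A3
open Polynomial
variable {F : Type} [Field F] [Fintype F] {V : Type} [AddCommGroup V] [Module F V]

noncomputable def D0 (F V : Type) [Field F] [Fintype F] : Polynomial (V → F) :=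
  ∏ a : F, (X - C (fun _ => a))

theorem D0_TD : TD (Fintype.card F) (D0 F V) := by
  apply TD.prod
  intro a _
  apply TD.X'.sub
  have := TD.CX (n := 1) (j := 0) (c := (fun _ => a : V → F)) (PD.const _ a) (Nat.zero_le _)
  simpa using this

theorem D0_coeff : (D0 F V).coeff (Fintype.card F) = 1 := by
  have h1 : (D0 F V).Monic := monic_prod_of_monic _ _ (fun a _ => monic_X_sub_C _)
  have h2 : (D0 F V).natDegree = Fintype.card F := by
    unfold D0
    rw [natDegree_prod_of_monic _ _ (fun a _ => monic_X_sub_C _)]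
    simp
  rw [← h2]; exact h1

theorem ev_D0 (x : V) : ev x (D0 F V) = ∏ a : F, (X - C a) := by
  unfold D0; rw [map_prod]
  refine Finset.prod_congr rfl (fun a _ => ?_)
  rw [map_sub, ev_X, ev_C]

theorem dvd_aux [DecidableEq F] (S : Finset (F × F)) (y a : F) (t : ℕ)
    (h : t ≤ (S.filter (fun s => a * s.1 + y * s.2 = 1)).card) :
    (X - C a) ^ t ∣ ∏ s ∈ S, (1 - C (s.2 * y) - C s.1 * X ^ 1 : F[X]) := by
  rw [← Finset.prod_filter_mul_prod_filter_not S (fun s => a * s.1 + y * s.2 = 1)]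
  apply Dvd.dvd.mul_right
  refine (pow_dvd_pow _ h).trans ?_
  rw [← Finset.prod_const]
  apply Finset.prod_dvd_prod_of_dvd
  intro s hs
  rw [Finset.mem_filter] at hs
  rw [dvd_iff_isRoot]
  simp
  linear_combination - hs.2

theorem bruen0 (S : Finset (F × F)) (t : ℕ) (ht : 1 ≤ t) (h0 : (0, 0) ∈ S) [DecidableEq F]
    (h : ∀ α β γ : F, (α ≠ 0 ∨ β ≠ 0) → t ≤ (S.filter (fun s => α * s.1 + β * s.2 = γ)).card) :
    (t + 1) * (Fintype.card F - 1) + 1 ≤ S.card := by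
  set q := Fintype.card F with hq
  have hq2 : 2 ≤ q := Fintype.one_lt_card
  set N := (S.erase (0,0)).card with hN
  have hNS : S.card = N + 1 := by rw [hN, Finset.card_erase_add_one h0]
  let G : Polynomial (F → F) :=
    ∏ s ∈ S.erase (0,0), (1 - C (fun y => s.2 * y) - C (fun _ => s.1) * X ^ 1)
  have hG : TD N G := by
    apply TD.prod
    intro s _
    refine ((TD.one 1).sub ?_).sub (TD.CX (PD.const _ _) le_rfl)
    have := TD.CX (n := 1) (j := 0) (c := (fun y => s.2 * y : F → F))
      ((PD.lin (LinearMap.id : F →ₗ[F] F)).smul s.2) (Nat.zero_le _)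
    simpa using this
  have evG : ∀ y, ev y G = ∏ s ∈ S.erase (0,0), (1 - C (s.2 * y) - C s.1 * X ^ 1) := by
    intro y
    simp only [G]
    rw [map_prod]
    refine Finset.prod_congr rfl (fun s _ => ?_)
    rw [map_sub, map_sub, map_mul, map_pow, ev_C, ev_C, ev_X, map_one]
  have hfil : ∀ α β : F, (α ≠ 0 ∨ β ≠ 0) →
      t ≤ ((S.erase (0,0)).filter (fun s => α * s.1 + β * s.2 = 1)).card := by
    intro α β hab
    refine (h α β 1 hab).trans (Finset.card_le_card ?_)
    intro s hs
    rw [Finset.mem_filter] at hs ⊢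
    refine ⟨Finset.mem_erase.2 ⟨?_, hs.1⟩, hs.2⟩
    rintro rfl
    simpa using hs.2
  have hdvd : ∀ (A : Finset F) (y : F), (∀ a ∈ A, a ≠ 0 ∨ y ≠ 0) →
      ∏ a ∈ A, (X - C a) ^ t ∣ ev y G := by
    intro A y hA
    rw [evG]
    apply Finset.prod_dvd_of_coprime
    · intro a _ b _ hab
      exact (pairwise_coprime_X_sub_C Function.injective_id hab).pow
    · intro a ha
      exact dvd_aux _ _ _ _ (hfil _ _ (hA a ha))
  let D := (D0 F F) ^ t
  have hD : TD (q * t) D := D0_TD.pow t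
  have hD1 : D.coeff (q * t) = 1 := by
    simp only [D]
    rw [mul_comm, coeff_pow_of_natDegree_le, D0_coeff, one_pow]
    rw [natDegree_le_iff_coeff_eq_zero]
    exact fun k hk => (D0_TD k).2 hk
  have evD : ∀ y, ev y D = ∏ a : F, (X - C a) ^ t := by
    intro y; simp only [D]; rw [map_pow, ev_D0, Finset.prod_pow]
  obtain ⟨Q, R, e, hR, hRk⟩ : ∃ Q R, G = D * Q + R ∧ TD N R ∧ ∀ k, q * t ≤ k → R.coeff k = 0 := by
    by_cases hc : q * t ≤ N
    · obtain ⟨Q, R, e, _, h1, h2⟩ := hD.div hD1 hc (N + 1) G hG (fun k hk => (hG k).2 (by omega))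
      exact ⟨Q, R, e, h1, h2⟩
    · exact ⟨0, G, by simp, hG, fun k hk => (hG k).2 (by omega)⟩
  have eR : ∀ y, ev y R = ev y G - (∏ a : F, (X - C a) ^ t) * ev y Q := by
    intro y; rw [e, map_add, map_mul, evD]; ring
  have hdR : ∀ (A : Finset F) (y : F), (∀ a ∈ A, a ≠ 0 ∨ y ≠ 0) →
      ∏ a ∈ A, (X - C a) ^ t ∣ ev y R := by
    intro A y hA
    rw [eR]
    refine dvd_sub (hdvd A y hA) (Dvd.dvd.mul_right ?_ _)
    exact Finset.prod_dvd_prod_of_subset _ _ _ (Finset.subset_univ _)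
  have degA : ∀ A : Finset F, (∏ a ∈ A, (X - C a) ^ t).natDegree = A.card * t := by
    intro A
    rw [natDegree_prod_of_monic _ _ (fun a _ => (monic_X_sub_C _).pow _)]
    simp
  have hRy : ∀ y, y ≠ 0 → ev y R = 0 := by
    intro y hy
    by_contra hne
    have h1 := natDegree_le_of_dvd (hdR Finset.univ y (fun a _ => Or.inr hy)) hne
    rw [degA, Finset.card_univ] at h1
    have h2 : (ev y R).coeff (ev y R).natDegree = 0 := by
      rw [ev_coeff, hRk _ (by rw [hq]; exact h1)]; rfl
    exact hne (leadingCoeff_eq_zero.1 h2)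
  have hR0 : ev 0 R ≠ 0 := by
    intro hz
    have h1 := eR 0
    rw [hz] at h1
    have h2 := congrArg (eval 0) h1
    rw [eval_sub, eval_mul, eval_prod, Finset.prod_eq_zero (Finset.mem_univ (0:F)), evG,
      eval_prod] at h2
    · simp at h2
    · simp; omega
  set i := (ev 0 R).natDegree with hi
  have hi1 : (q - 1) * t ≤ i := by
    have h1 := natDegree_le_of_dvd (hdR (Finset.univ.erase 0) 0 (fun a ha => Or.inl (by simpa using ha))) hR0
    rw [degA, Finset.card_erase_of_mem (Finset.mem_univ _), Finset.card_univ] at h1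
    exact h1
  have hci : R.coeff i 0 ≠ 0 := by
    rw [← ev_coeff, hi]
    exact fun hh => hR0 (leadingCoeff_eq_zero.1 hh)
  have hiN : i ≤ N := by
    by_contra hc
    rw [(hR i).2 (by omega)] at hci; exact hci rfl
  have hPD := (hR i).1 hiN
  have : q - 1 ≤ N - i := by
    by_contra hc
    have := hPD.roots 0 1 (Finset.univ.erase 0) (by
      rw [Finset.card_erase_of_mem (Finset.mem_univ _), Finset.card_univ]; omega) (by
      intro s hs
      have hs0 : s ≠ 0 := by simpa using hs
      rw [← ev_coeff, hRy]; simp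
      simpa using hs0) 0
    apply hci; simpa using this
  rw [hNS]
  have : (t + 1) * (q - 1) = (q-1)*t + (q - 1) := by ring
  omega

theorem bruen (S : Finset (F × F)) (t : ℕ) (ht : 1 ≤ t) [DecidableEq F]
    (h : ∀ α β γ : F, (α ≠ 0 ∨ β ≠ 0) → t ≤ (S.filter (fun s => α * s.1 + β * s.2 = γ)).card) :
    (t + 1) * (Fintype.card F - 1) + 1 ≤ S.card := by
  obtain ⟨p, hp⟩ : S.Nonempty := by
    have := h 1 0 0 (by simp)
    have h2 : 0 < (S.filter (fun s => 1 * s.1 + 0 * s.2 = (0:F))).card := by omega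
    exact (Finset.card_pos.1 h2).mono (Finset.filter_subset _ _)
  have := bruen0 (S.image (fun s => s - p)) t ht (by
    rw [Finset.mem_image]; exact ⟨p, hp, sub_self p⟩) (by
    intro α β γ hab
    refine (h α β (γ + α * p.1 + β * p.2) hab).trans ?_
    rw [Finset.filter_image, Finset.card_image_of_injective _ (sub_left_injective)]
    apply Finset.card_le_card
    intro s hs
    rw [Finset.mem_filter] at hs ⊢
    refine ⟨hs.1, ?_⟩
    simp only [Prod.fst_sub, Prod.snd_sub]
    linear_combination hs.2)
  rwa [Finset.card_image_of_injective _ (sub_left_injective)] at this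
end A3

set_option linter.unusedSectionVars false

section cnt
open scoped Classical

noncomputable def cnt {V : Type} (P : V → Prop) : ℕ := Set.ncard {x | P x}

variable {F : Type} [Field F] [Fintype F] {V : Type} [AddCommGroup V] [Module F V] [Finite V]

theorem cnt_congr {V : Type} {P Q : V → Prop} (h : ∀ x, P x ↔ Q x) : cnt P = cnt Q := by
  have : P = Q := funext fun x => propext (h x)
  rw [this]

theorem cnt_mono {V : Type} [Finite V] {P Q : V → Prop} (h : ∀ x, P x → Q x) : cnt P ≤ cnt Q :=
  Set.ncard_le_ncard h (Set.toFinite _)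

theorem cnt_eq {V : Type} [Fintype V] (P : V → Prop) [DecidablePred P] : cnt P = (Finset.univ.filter P).card := by
  rw [cnt, ← Set.ncard_coe_finset]; simp

theorem cnt_fiber {V : Type} [Finite V] (P : V → Prop) (h : V → F) :
    cnt P = ∑ a : F, cnt (fun x => P x ∧ h x = a) := by
  cases nonempty_fintype V
  rw [cnt_eq, Finset.card_eq_sum_card_fiberwise (f := h) (t := Finset.univ) (by simp)]
  refine Finset.sum_congr rfl fun a _ => ?_
  rw [cnt_eq, Finset.filter_filter]

theorem cnt_zero {V : Type} {P : V → Prop} (h : ∀ x, ¬ P x) : cnt P = 0 := by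
  have : {x | P x} = ∅ := by ext x; simp [h x]
  rw [cnt, this, Set.ncard_empty]

theorem cnt_true {V : Type} : cnt (fun _ : V => True) = Nat.card V := by
  simp [cnt, Set.ncard_univ]

theorem cnt_split {V : Type} [Finite V] (P Q : V → Prop) :
    cnt P = cnt (fun x => P x ∧ Q x) + cnt (fun x => P x ∧ ¬ Q x) := by
  exact (Set.ncard_inter_add_ncard_sdiff_eq_ncard {x | P x} {x | Q x} (Set.toFinite _)).symm

theorem cnt_pos {V : Type} [Finite V] {P : V → Prop} (x : V) (h : P x) : 0 < cnt P :=
  (Set.ncard_pos (Set.toFinite _)).2 ⟨x, h⟩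

theorem cnt_slice (P : V → Prop) (y : V →ₗ[F] F) (a : F) (p : V) (hp : y p = a) :
    cnt (fun x => P x ∧ y x = a) = cnt (fun w : LinearMap.ker y => P (p + w)) := by
  have : {x | P x ∧ y x = a} = (fun w : LinearMap.ker y => p + (w : V)) '' {w | P (p + w)} := by
    ext x
    constructor
    · rintro ⟨h1, h2⟩
      refine ⟨⟨x - p, by simp [h2, hp]⟩, ?_, ?_⟩
      · simpa using h1
      · simp
    · rintro ⟨w, h1, rfl⟩
      have hw : y (w : V) = 0 := w.2
      exact ⟨h1, by simp [hp, hw]⟩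
  rw [cnt, cnt, this, Set.ncard_image_of_injective]
  intro w w' h
  exact Subtype.ext (add_left_cancel h)

theorem card_ker (y : V →ₗ[F] F) (hy : y ≠ 0) :
    Fintype.card F * Nat.card (LinearMap.ker y) = Nat.card V := by
  rw [← cnt_true (V := V), cnt_fiber (F := F) _ (fun x => y x)]
  rw [Finset.sum_congr rfl (fun a _ => ?_), Finset.sum_const, Finset.card_univ, smul_eq_mul]
  obtain ⟨p, hp⟩ := exists_val y hy a
  rw [cnt_slice _ y a p hp, cnt_true]

theorem cnt_hyp (y : V →ₗ[F] F) (hy : y ≠ 0) (a : F) :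
    Fintype.card F * cnt (fun x => y x = a) = Nat.card V := by
  obtain ⟨p, hp⟩ := exists_val y hy a
  rw [← card_ker y hy, cnt_congr (Q := fun x => True ∧ y x = a) (by simp), cnt_slice _ y a p hp,
    cnt_true]

theorem cnt_flat (y L : V →ₗ[F] F) (hy : y ≠ 0) (hL : ∃ v, y v = 0 ∧ L v = 1) (a e : F) :
    Fintype.card F * (Fintype.card F * cnt (fun x => y x = a ∧ L x = e)) = Nat.card V := by
  obtain ⟨p, hp⟩ := exists_val y hy a
  obtain ⟨v, hv, hv1⟩ := hL
  rw [← card_ker y hy, cnt_congr (Q := fun x => L x = e ∧ y x = a) (by tauto),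
    cnt_slice _ y a p hp]
  congr 1
  rw [← cnt_hyp (L ∘ₗ (LinearMap.ker y).subtype) ?_ (e - L p)]
  · congr 1
    apply cnt_congr
    intro w
    simp only [map_add, LinearMap.comp_apply, Submodule.subtype_apply]
    constructor <;> intro h <;> linear_combination h
  · intro h
    have := LinearMap.congr_fun h ⟨v, hv⟩
    simp [hv1] at this

theorem cnt_pencil (P : V → Prop) (y M : V →ₗ[F] F) (a κ : F)
    (h : ∀ x, y x = a → M x = κ → ¬ P x) :
    cnt P = cnt (fun x => P x ∧ y x = a) +
      ∑ s : F, cnt (fun x => P x ∧ (M - s • y) x = κ - s * a) := by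
  rw [cnt_split P (fun x => y x = a)]
  congr 1
  rw [cnt_fiber (F := F) _ (fun x => (M x - κ) / (y x - a))]
  refine Finset.sum_congr rfl fun s _ => cnt_congr fun x => ?_
  simp only [LinearMap.sub_apply, LinearMap.smul_apply, smul_eq_mul]
  constructor
  · rintro ⟨⟨h1, h2⟩, h3⟩
    rw [div_eq_iff (sub_ne_zero.2 h2)] at h3
    exact ⟨h1, by linear_combination h3⟩
  · rintro ⟨h1, h2⟩
    have h3 : y x ≠ a := by
      intro h4
      exact h x h4 (by rw [h4] at h2; linear_combination h2) h1
    refine ⟨⟨h1, h3⟩, ?_⟩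
    rw [div_eq_iff (sub_ne_zero.2 h3)]
    linear_combination h2

theorem card_V_pos : 0 < Nat.card V := Nat.card_pos

end cnt

set_option linter.unusedSectionVars false

section A5
open scoped Classical
variable {F : Type} [Field F] [Fintype F] {V : Type} [AddCommGroup V] [Module F V] [Finite V]

theorem PD.restr {n : ℕ} {f : V → F} (hf : PD F n f) (y : V →ₗ[F] F) (p : V) :
    PD F n (fun w : LinearMap.ker y => f (p + w)) := hf.comp (LinearMap.ker y).subtype p

def LBp (F : Type) [Field F] [Fintype F] (V : Type) [AddCommGroup V] [Module F V] : Prop :=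
  ∀ (n c : ℕ) (f : V → F), PD F n f → n + c = Fintype.card F → 1 ≤ c → (∃ x, f x ≠ 0) →
    c * Nat.card V ≤ Fintype.card F * cnt (fun x => f x ≠ 0)

theorem slice0 (y : V →ₗ[F] F) (hy : y ≠ 0) (hLB : LBp F (LinearMap.ker y))
    {n c : ℕ} {f : V → F} (hf : PD F n f) (hc : n + c = Fintype.card F) (hc1 : 1 ≤ c)
    (h0 : ∃ x, f x ≠ 0) :
    ∃ (K : Finset F) (g : V → F), K.card ≤ n ∧ PD F (n - K.card) g ∧
      (∀ x, f x = (∏ a ∈ K, (y x - a)) * g x) ∧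
      (∀ a, a ∈ K ↔ ∀ x, y x = a → f x = 0) ∧
      (∀ a, a ∉ K → (c + K.card) * Nat.card V ≤
        Fintype.card F * (Fintype.card F * cnt (fun x => f x ≠ 0 ∧ y x = a))) ∧
      (Fintype.card F - K.card) * (c + K.card) * Nat.card V ≤
        Fintype.card F * (Fintype.card F * cnt (fun x => f x ≠ 0)) := by
  set K : Finset F := Finset.univ.filter (fun a => ∀ x, y x = a → f x = 0) with hK
  have hKm : ∀ a, a ∈ K ↔ ∀ x, y x = a → f x = 0 := by intro a; simp [hK]
  rcases PD.fac K (fun _ => y) (fun a => a) n f hf (by omega) (fun _ _ => hy) (by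
    intro i _ j _ hij
    obtain ⟨x, hx⟩ := exists_val y hy j
    exact ⟨x, hx, fun h => hij (by rw [← h, hx])⟩) (fun i hi x hx => (hKm i).1 hi x hx) with h | h
  · obtain ⟨x, hx⟩ := h0
    exact absurd (h x) hx
  obtain ⟨hk, g, hg, hfg⟩ := h
  have hsl : ∀ a, a ∉ K → (c + K.card) * Nat.card V ≤
        Fintype.card F * (Fintype.card F * cnt (fun x => f x ≠ 0 ∧ y x = a)) := by
    intro a ha
    have ha' := ha
    rw [hKm] at ha'
    push Not at ha'
    obtain ⟨p, hp, hp0⟩ := ha'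
    have h1 := hLB (n - K.card) (c + K.card) _ (hg.restr y p) (by omega) (by omega)
      ⟨0, by
        intro h; apply hp0; rw [hfg]; simp at h; rw [h, mul_zero]⟩
    rw [← card_ker y hy, cnt_congr (Q := fun x => g x ≠ 0 ∧ y x = a), cnt_slice _ y a p hp]
    · calc _ = Fintype.card F * ((c + K.card) * Nat.card (LinearMap.ker y)) := by ring
        _ ≤ _ := Nat.mul_le_mul_left _ h1
    · intro x
      rw [hfg]
      constructor
      · rintro ⟨h1, h2⟩; exact ⟨right_ne_zero_of_mul h1, h2⟩
      · rintro ⟨h1, h2⟩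
        refine ⟨mul_ne_zero ?_ h1, h2⟩
        rw [h2, Finset.prod_ne_zero_iff]
        intro b hb hab
        rw [sub_eq_zero] at hab
        exact ha (hab ▸ hb)
  refine ⟨K, g, hk, hg, hfg, hKm, hsl, ?_⟩
  rw [cnt_fiber (F := F) (fun x => f x ≠ 0) (fun x => y x), Finset.mul_sum, Finset.mul_sum]
  calc (Fintype.card F - K.card) * (c + K.card) * Nat.card V
      = ∑ a ∈ Kᶜ, (c + K.card) * Nat.card V := by
        rw [Finset.sum_const, Finset.card_compl, smul_eq_mul]; ring
    _ ≤ ∑ a ∈ Kᶜ, Fintype.card F * (Fintype.card F * cnt (fun x => f x ≠ 0 ∧ y x = a)) := by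
        apply Finset.sum_le_sum
        intro a ha
        exact hsl a (by simpa using ha)
    _ ≤ _ := Finset.sum_le_sum_of_subset (Finset.subset_univ _)

theorem card_ker_lt (y : V →ₗ[F] F) (hy : y ≠ 0) : Nat.card (LinearMap.ker y) < Nat.card V := by
  have h := card_ker y hy
  have h1 : 0 < Nat.card (LinearMap.ker y) := Nat.card_pos
  have h2 : 1 < Fintype.card F := Fintype.one_lt_card
  nlinarith

theorem triv_of_no_lin (h : ∀ y : V →ₗ[F] F, y = 0) : Nat.card V = 1 := by
  rw [Nat.card_eq_one_iff_unique]
  refine ⟨⟨fun a b => ?_⟩, ⟨0⟩⟩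
  rw [← sub_eq_zero, ← Module.forall_dual_apply_eq_zero_iff F]
  intro φ
  rw [h φ]; rfl

theorem LB1_aux (N : ℕ) : ∀ (V : Type) [AddCommGroup V] [Module F V] [Finite V],
    Nat.card V = N → LBp F V := by
  induction N using Nat.strong_induction_on with
  | _ N ih =>
    intro V _ _ _ hN n c f hf hc hc1 h0
    by_cases hy : ∃ y : V →ₗ[F] F, y ≠ 0
    · obtain ⟨y, hy⟩ := hy
      obtain ⟨K, g, hk, -, -, -, -, h⟩ := slice0 y hy
        (ih _ (hN ▸ card_ker_lt y hy) _ rfl) hf hc hc1 h0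
      have h2 : 0 < Fintype.card F := Fintype.card_pos
      refine Nat.le_of_mul_le_mul_left (le_trans ?_ h) h2
      rw [← mul_assoc]
      apply Nat.mul_le_mul_right
      obtain ⟨j, rfl⟩ := Nat.exists_eq_add_of_le hk
      rw [← hc]
      have : K.card + j + c - K.card = j + c := by omega
      rw [this]
      nlinarith
    · push Not at hy
      rw [triv_of_no_lin hy]
      obtain ⟨x, hx⟩ := h0
      have := cnt_pos (P := fun x => f x ≠ 0) x hx
      nlinarith

theorem LB1 : LBp F V := LB1_aux _ V rfl

theorem slice (y : V →ₗ[F] F) (hy : y ≠ 0)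
    {n c : ℕ} {f : V → F} (hf : PD F n f) (hc : n + c = Fintype.card F) (hc1 : 1 ≤ c)
    (h0 : ∃ x, f x ≠ 0) :
    ∃ (K : Finset F) (g : V → F), K.card ≤ n ∧ PD F (n - K.card) g ∧
      (∀ x, f x = (∏ a ∈ K, (y x - a)) * g x) ∧
      (∀ a, a ∈ K ↔ ∀ x, y x = a → f x = 0) ∧
      (∀ a, a ∉ K → (c + K.card) * Nat.card V ≤
        Fintype.card F * (Fintype.card F * cnt (fun x => f x ≠ 0 ∧ y x = a))) ∧
      (Fintype.card F - K.card) * (c + K.card) * Nat.card V ≤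
        Fintype.card F * (Fintype.card F * cnt (fun x => f x ≠ 0)) :=
  slice0 y hy LB1 hf hc hc1 h0

/-- lower bound on a hyperplane -/
theorem LB1h (y : V →ₗ[F] F) (hy : y ≠ 0) (a : F)
    {n c : ℕ} {f : V → F} (hf : PD F n f) (hc : n + c = Fintype.card F) (hc1 : 1 ≤ c)
    (h0 : ∃ x, y x = a ∧ f x ≠ 0) :
    c * Nat.card V ≤ Fintype.card F * (Fintype.card F * cnt (fun x => f x ≠ 0 ∧ y x = a)) := by
  obtain ⟨p, hp, hp0⟩ := h0
  have h1 := LB1 (V := LinearMap.ker y) n c _ (hf.restr y p) hc hc1 ⟨0, by simpa using hp0⟩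
  rw [← card_ker y hy, cnt_slice _ y a p hp]
  calc _ = Fintype.card F * (c * Nat.card (LinearMap.ker y)) := by ring
    _ ≤ _ := Nat.mul_le_mul_left _ h1

end A5

set_option linter.unusedSectionVars false

section A6
open scoped Classical
variable {F : Type} [Field F] [Fintype F] {V : Type} [AddCommGroup V] [Module F V] [Finite V]

def Tp (F : Type) [Field F] [Fintype F] (V : Type) [AddCommGroup V] [Module F V] : Prop :=
  ∀ (n c : ℕ) (f : V → F), PD F n f → n + c = Fintype.card F → 1 ≤ c → (∃ x, f x ≠ 0) →
    Fintype.card F * (Fintype.card F * cnt (fun x => f x ≠ 0)) ≤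
      (c + 1) * (Fintype.card F - 1) * Nat.card V →
    ∃ (y : V →ₗ[F] F) (a : F), y ≠ 0 ∧ ∀ x, y x = a → f x = 0

theorem struct0 (hT : Tp F V) {n c : ℕ} {f : V → F} (hf : PD F n f) (hc : n + c = Fintype.card F)
    (hc1 : 1 ≤ c) (h0 : ∃ x, f x ≠ 0)
    (h : Fintype.card F * (Fintype.card F * cnt (fun x => f x ≠ 0)) <
      (c + 1) * (Fintype.card F - 1) * Nat.card V ∨
      (1 ≤ n ∧ Fintype.card F * cnt (fun x => f x ≠ 0) ≤ c * Nat.card V)) :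
    ∃ (M : V →ₗ[F] F) (K : Finset F) (φ : F → F), M ≠ 0 ∧ K.card = n ∧
      (∀ x, f x = φ (M x)) ∧ ∀ t, φ t = 0 ↔ t ∈ K := by
  have hN : 0 < Nat.card V := Nat.card_pos
  obtain ⟨y, a, hy, hya⟩ := hT n c f hf hc hc1 h0 (by
    rcases h with h | ⟨h1, h⟩
    · exact h.le
    · calc _ ≤ Fintype.card F * (c * Nat.card V) := Nat.mul_le_mul_left _ h
        _ = (Fintype.card F * c) * Nat.card V := by ring
        _ ≤ _ := by
          apply Nat.mul_le_mul_right
          rw [← hc]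
          obtain ⟨n, rfl⟩ := Nat.exists_eq_add_of_le h1
          have : 1 + n + c - 1 = n + c := by omega
          rw [this]; nlinarith)
  obtain ⟨K, g, hk, hg, hfg, hK, -, hs⟩ := slice y hy hf hc hc1 h0
  have haK : a ∈ K := (hK a).2 hya
  have hk1 : 1 ≤ K.card := Finset.card_pos.2 ⟨a, haK⟩
  have hkn : K.card = n := by
    obtain ⟨j, rfl⟩ := Nat.exists_eq_add_of_le hk
    have e1 : Fintype.card F - K.card = j + c := by omega
    rw [e1] at hs
    rcases h with h | ⟨h1, h⟩
    · have h2 := hs.trans_lt h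
      have h3 := lt_of_mul_lt_mul_right h2 (Nat.zero_le _)
      obtain ⟨k, hk'⟩ := Nat.exists_eq_add_of_le hk1
      have e2 : Fintype.card F - 1 = k + j + c := by omega
      rw [e2, hk'] at h3
      rw [hk']
      by_contra hne
      have : 1 ≤ j := by omega
      obtain ⟨i, rfl⟩ := Nat.exists_eq_add_of_le this
      nlinarith
    · have h2 := hs.trans (Nat.mul_le_mul_left _ h)
      rw [← mul_assoc] at h2
      have h3 := le_of_mul_le_mul_right h2 hN
      rw [← hc] at h3
      by_contra hne
      have : 1 ≤ j := by omega
      nlinarith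
  have : n - K.card = 0 := by omega
  rw [this] at hg
  obtain ⟨e, he⟩ := hg.eq_const
  refine ⟨y, K, fun t => (∏ a ∈ K, (t - a)) * e, hy, hkn, fun x => by rw [hfg, he], fun t => ?_⟩
  have hene : e ≠ 0 := by
    rintro rfl
    obtain ⟨x, hx⟩ := h0
    exact hx (by rw [hfg, he, mul_zero])
  simp only [mul_eq_zero, hene, or_false, Finset.prod_eq_zero_iff, sub_eq_zero]
  constructor
  · rintro ⟨b, hb, rfl⟩; exact hb
  · intro h; exact ⟨t, h, rfl⟩

theorem exists_ext (y : V →ₗ[F] F) (M' : LinearMap.ker y →ₗ[F] F) (hM : M' ≠ 0) :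
    ∃ M : V →ₗ[F] F, (∀ w : LinearMap.ker y, M w = M' w) ∧ ∃ v, y v = 0 ∧ M v = 1 := by
  obtain ⟨M, h⟩ := LinearMap.exists_extend M'
  refine ⟨M, fun w => LinearMap.congr_fun h w, ?_⟩
  obtain ⟨v, hv⟩ := exists_one M' hM
  exact ⟨v, v.2, by rw [← hv, ← h]; rfl⟩

theorem T_hyp (y : V →ₗ[F] F) (hy : y ≠ 0) (a : F) (hT : Tp F (LinearMap.ker y))
    {n c : ℕ} {f : V → F} (hf : PD F n f) (hc : n + c = Fintype.card F) (hc1 : 1 ≤ c)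
    (h0 : ∃ x, y x = a ∧ f x ≠ 0)
    (h : Fintype.card F * (Fintype.card F * (Fintype.card F * cnt (fun x => f x ≠ 0 ∧ y x = a))) ≤
      (c + 1) * (Fintype.card F - 1) * Nat.card V) :
    ∃ (M : V →ₗ[F] F) (κ : F), (∃ v, y v = 0 ∧ M v = 1) ∧ ∀ x, y x = a → M x = κ → f x = 0 := by
  obtain ⟨p, hp, hp0⟩ := h0
  have hq : 0 < Fintype.card F := Fintype.card_pos
  rw [← card_ker y hy, cnt_slice _ y a p hp, mul_left_comm ((c + 1) * (Fintype.card F - 1)) (Fintype.card F)] at h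
  have h2 := Nat.le_of_mul_le_mul_left h hq
  obtain ⟨M', κ, hM', hk⟩ := hT n c _ (hf.restr y p) hc hc1 ⟨0, by simpa using hp0⟩ h2
  obtain ⟨M, hM, v⟩ := exists_ext y M' hM'
  refine ⟨M, κ + M p, v, fun x hx hxM => ?_⟩
  have hxp : y (x - p) = 0 := by rw [map_sub, hx, hp, sub_self]
  have := hk ⟨x - p, hxp⟩ (by rw [← hM]; simp [hxM])
  simpa using this

theorem struct0_hyp (y : V →ₗ[F] F) (hy : y ≠ 0) (a : F) (hT : Tp F (LinearMap.ker y))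
    {n c : ℕ} {f : V → F} (hf : PD F n f) (hc : n + c = Fintype.card F) (hc1 : 1 ≤ c)
    (h0 : ∃ x, y x = a ∧ f x ≠ 0)
    (h : Fintype.card F * (Fintype.card F * (Fintype.card F * cnt (fun x => f x ≠ 0 ∧ y x = a))) <
      (c + 1) * (Fintype.card F - 1) * Nat.card V ∨
      (1 ≤ n ∧ Fintype.card F * (Fintype.card F * cnt (fun x => f x ≠ 0 ∧ y x = a)) ≤ c * Nat.card V)) :
    ∃ (M : V →ₗ[F] F) (K : Finset F) (φ : F → F), (∃ v, y v = 0 ∧ M v = 1) ∧ K.card = n ∧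
      (∀ x, y x = a → f x = φ (M x)) ∧ ∀ t, φ t = 0 ↔ t ∈ K := by
  obtain ⟨p, hp, hp0⟩ := h0
  have hq : 0 < Fintype.card F := Fintype.card_pos
  rw [← card_ker y hy, cnt_slice _ y a p hp, mul_left_comm ((c + 1) * (Fintype.card F - 1)) (Fintype.card F),
    mul_left_comm c (Fintype.card F)] at h
  obtain ⟨M', K, φ, hM', hk, h1, h2⟩ := struct0 hT (hf.restr y p) hc hc1 ⟨0, by simpa using hp0⟩ (by
    rcases h with h | ⟨h, h'⟩
    · exact Or.inl (Nat.lt_of_mul_lt_mul_left h)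
    · exact Or.inr ⟨h, Nat.le_of_mul_le_mul_left h' hq⟩)
  obtain ⟨M, hM, v⟩ := exists_ext y M' hM'
  refine ⟨M, K.image (· + M p), fun t => φ (t - M p), v, ?_, fun x hx => ?_, fun t => ?_⟩
  · rw [Finset.card_image_of_injective _ (add_left_injective _), hk]
  · have hxp : y (x - p) = 0 := by rw [map_sub, hx, hp, sub_self]
    have := h1 ⟨x - p, hxp⟩
    rw [← hM] at this
    simpa using this
  · rw [h2, Finset.mem_image]
    constructor
    · intro h; exact ⟨_, h, by simp⟩
    · rintro ⟨s, hs, rfl⟩; simpa using hs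

theorem cnt_fiber' {T : Type} [Fintype T] {V : Type} [Finite V] (P : V → Prop) (h : V → T) :
    cnt P = ∑ a : T, cnt (fun x => P x ∧ h x = a) := by
  cases nonempty_fintype V
  rw [cnt_eq, Finset.card_eq_sum_card_fiberwise (f := h) (t := Finset.univ) (by simp)]
  refine Finset.sum_congr rfl fun a _ => ?_
  rw [cnt_eq, Finset.filter_filter]

theorem bruen_case (y L : V →ₗ[F] F) (u v : V) (hyu : y u = 1) (hyv : y v = 0) (hLu : L u = 0)
    (hLv : L v = 1) {n c : ℕ} {f : V → F} (hf : PD F n f) (hc : n + c = Fintype.card F)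
    (hc1 : 1 ≤ c) (hD : ∀ w, y w = 0 → L w = 0 → ∀ x, f (x + w) = f x)
    (hno : ∀ (y : V →ₗ[F] F) (a : F), y ≠ 0 → ∃ x, y x = a ∧ f x ≠ 0) :
    (c + 1) * (Fintype.card F - 1) * Nat.card V <
    Fintype.card F * (Fintype.card F * cnt (fun x => f x ≠ 0)) := by
  have hN : 0 < Nat.card V := Nat.card_pos
  have hq : 0 < Fintype.card F := Fintype.card_pos
  let ψ : F × F →ₗ[F] V :=
    (LinearMap.fst F F F).smulRight u + (LinearMap.snd F F F).smulRight v
  have hψ : ∀ s, ψ s = s.1 • u + s.2 • v := fun s => rfl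
  have hdep : ∀ x, f x = f (ψ (y x, L x)) := by
    intro x
    have := hD (x - ψ (y x, L x)) (by simp [hψ, hyu, hyv]) (by simp [hψ, hLu, hLv]) (ψ (y x, L x))
    rw [← this]; congr 1; abel
  set S : Finset (F × F) := Finset.univ.filter (fun s => f (ψ s) ≠ 0) with hS
  have hPD : PD F n (fun s => f (ψ s)) := (hf.comp ψ 0).congr (by simp)
  have hB := bruen S c hc1 (by
    intro α β γ hab
    let l : F × F →ₗ[F] F := α • LinearMap.fst F F F + β • LinearMap.snd F F F
    have hl : ∀ s, l s = α * s.1 + β * s.2 := fun s => rfl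
    have hl0 : l ≠ 0 := by
      intro h
      rcases hab with h1 | h1
      · apply h1; have := hl (1, 0); rw [h] at this; simpa using this.symm
      · apply h1; have := hl (0, 1); rw [h] at this; simpa using this.symm
    obtain ⟨x, hx, hx0⟩ := hno (α • y + β • L) γ (by
      intro h
      apply hl0
      ext
      · have := LinearMap.congr_fun h u
        simp [hyu, hLu] at this; simp [hl, this]
      · have := LinearMap.congr_fun h v
        simp [hyv, hLv] at this; simp [hl, this])
    have h1 := LB1h l hl0 γ hPD hc hc1 ⟨(y x, L x), by simpa [hl] using hx, by
      rw [← hdep]; exact hx0⟩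
    rw [Nat.card_prod, Nat.card_eq_fintype_card, mul_comm c, mul_assoc] at h1
    have h2 := Nat.le_of_mul_le_mul_left h1 hq
    have h3 := Nat.le_of_mul_le_mul_left h2 hq
    rw [cnt_eq] at h3
    refine h3.trans (Finset.card_le_card fun s hs => ?_)
    rw [Finset.mem_filter] at hs
    rw [Finset.mem_filter, hS, Finset.mem_filter]
    exact ⟨⟨Finset.mem_univ _, hs.2.1⟩, hs.2.2⟩)
  have hsum : S.card * Nat.card V ≤ Fintype.card F * (Fintype.card F * cnt (fun x => f x ≠ 0)) := by
    rw [cnt_fiber' (fun x => f x ≠ 0) (fun x => (y x, L x)), Finset.mul_sum, Finset.mul_sum]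
    calc S.card * Nat.card V = ∑ s ∈ S, Nat.card V := by simp
      _ ≤ ∑ s ∈ S, Fintype.card F * (Fintype.card F *
          cnt (fun x => f x ≠ 0 ∧ (y x, L x) = s)) := by
        apply Finset.sum_le_sum
        intro s hs
        have hs' : f (ψ s) ≠ 0 := by simpa [hS] using hs
        rw [← cnt_flat y L (by rintro rfl; simp at hyu) ⟨v, hyv, hLv⟩ s.1 s.2]
        apply Nat.mul_le_mul_left
        apply Nat.mul_le_mul_left
        apply cnt_mono
        rintro x ⟨h1, h2⟩
        have : (y x, L x) = s := Prod.ext h1 h2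
        exact ⟨by rw [hdep, this]; exact hs', this⟩
      _ ≤ _ := Finset.sum_le_sum_of_subset (Finset.subset_univ _)
  nlinarith

end A6

set_option linter.unusedSectionVars false

section A7
open scoped Classical
variable {F : Type} [Field F] [Fintype F] {V : Type} [AddCommGroup V] [Module F V] [Finite V]

theorem pencil_ne (y M : V →ₗ[F] F) (hM : ∃ v, y v = 0 ∧ M v = 1) (s : F) : M - s • y ≠ 0 := by
  obtain ⟨v, h1, h2⟩ := hM
  intro h
  have := LinearMap.congr_fun h v
  simp [h1, h2] at this

theorem basis2 (y L : V →ₗ[F] F) (hy : y ≠ 0) (hL : ∃ v, y v = 0 ∧ L v = 1) :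
    ∃ u v, y u = 1 ∧ y v = 0 ∧ L u = 0 ∧ L v = 1 := by
  obtain ⟨u, hu⟩ := exists_one y hy
  obtain ⟨v, hv, hv1⟩ := hL
  exact ⟨u - L u • v, v, by simp [hu, hv], hv, by simp [hv1], hv1⟩

theorem exists_pt (y L : V →ₗ[F] F) (hy : y ≠ 0) (hL : ∃ v, y v = 0 ∧ L v = 1) (α β : F) :
    ∃ x, y x = α ∧ L x = β := by
  obtain ⟨u, v, h1, h2, h3, h4⟩ := basis2 y L hy hL
  exact ⟨α • u + β • v, by simp [h1, h2], by simp [h3, h4]⟩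

theorem indep_of_zero {n : ℕ} (hn : n < Fintype.card F) {K : Finset F} (hK : K.card = n)
    {φ : F → F} (hφ : ∀ t, φ t = 0 ↔ t ∈ K) (M : V →ₗ[F] F) (x w : V)
    (h : ∀ s : F, φ (M (x + s • w)) = 0) : M w = 0 := by
  by_contra hw
  have : K = Finset.univ := by
    ext t
    simp only [Finset.mem_univ, iff_true]
    rw [← hφ]
    have := h ((t - M x) / M w)
    rwa [map_add, map_smul, smul_eq_mul, div_mul_cancel₀ _ hw, add_sub_cancel] at this
  rw [this, Finset.card_univ] at hK
  omega

theorem T_aux (N : ℕ) : ∀ (V : Type) [AddCommGroup V] [Module F V] [Finite V],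
    Nat.card V = N → Tp F V := by
  induction N using Nat.strong_induction_on with
  | _ N ih =>
    intro V _ _ _ hN n c f hf hc hc1 h0 hle
    have hNp : 0 < Nat.card V := Nat.card_pos
    have hq2 : 1 < Fintype.card F := Fintype.one_lt_card
    have hT : ∀ y : V →ₗ[F] F, y ≠ 0 → Tp F (LinearMap.ker y) := fun y hy =>
      ih _ (hN ▸ card_ker_lt y hy) _ rfl
    by_contra hno'
    have hno : ∀ (y : V →ₗ[F] F) (a : F), y ≠ 0 → ∃ x, y x = a ∧ f x ≠ 0 := by
      intro y a hy
      by_contra h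
      push Not at h
      exact hno' ⟨y, a, hy, h⟩
    set q := Fintype.card F with hqd
    set W := (c + 1) * (q - 1) * Nat.card V with hW
    have hWp : 0 < W := by
      apply Nat.mul_pos _ hNp
      apply Nat.mul_pos <;> omega
    by_cases hy : ∃ y : V →ₗ[F] F, y ≠ 0
    swap
    · push Not at hy
      rw [hW, triv_of_no_lin hy] at hle
      obtain ⟨x, hx⟩ := h0
      have := cnt_pos (P := fun x => f x ≠ 0) x hx
      obtain ⟨k, hk⟩ := Nat.exists_eq_add_of_lt hq2
      have e : q - 1 = 0 + k + 1 := by omega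
      have e2 : q * q ≤ q * (q * cnt (fun x => f x ≠ 0)) := by
        apply Nat.mul_le_mul_left; nlinarith
      rw [e] at hle
      have : c ≤ q := by omega
      nlinarith
    obtain ⟨y, hy⟩ := hy
    -- a light slice
    obtain ⟨a, ha⟩ : ∃ a, q * (q * (q * cnt (fun x => f x ≠ 0 ∧ y x = a))) ≤ W := by
      by_contra h
      push Not at h
      rw [cnt_fiber (F := F) _ (fun x => y x), Finset.mul_sum, Finset.mul_sum] at hle
      have h2 := Nat.mul_le_mul_left q hle
      rw [Finset.mul_sum] at h2
      have h3 : ∑ a : F, W < ∑ a : F, q * (q * (q * cnt (fun x => f x ≠ 0 ∧ y x = a))) :=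
        Finset.sum_lt_sum_of_nonempty ⟨0, Finset.mem_univ _⟩ (fun a _ => h a)
      rw [Finset.sum_const, Finset.card_univ, smul_eq_mul, ← hqd] at h3
      omega
    obtain ⟨M, κ, hM, hMz⟩ := T_hyp y hy a (hT y hy) hf hc hc1 (hno y a hy) ha
    -- a strictly light hyperplane
    obtain ⟨y1, a1, hy1, h1⟩ : ∃ (y1 : V →ₗ[F] F) (a1 : F), y1 ≠ 0 ∧
        q * (q * (q * cnt (fun x => f x ≠ 0 ∧ y1 x = a1))) < W := by
      by_contra h
      push Not at h
      have hp := cnt_pencil (fun x => f x ≠ 0) y M a κ (fun x h1 h2 => by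
        simpa using hMz x h1 h2)
      have h2 := Nat.mul_le_mul_left q hle
      rw [hp, mul_add, mul_add, mul_add, Finset.mul_sum, Finset.mul_sum, Finset.mul_sum] at h2
      have h3 := h y a hy
      have h4 : ∑ s : F, W ≤ ∑ s : F, q * (q * (q * cnt (fun x => f x ≠ 0 ∧
          (M - s • y) x = κ - s * a))) :=
        Finset.sum_le_sum fun s _ => h (M - s • y) (κ - s * a) (pencil_ne y M hM s)
      rw [Finset.sum_const, Finset.card_univ, smul_eq_mul, ← hqd] at h4
      omega
    obtain ⟨L, K, φ, hL, hK, hfL, hφ⟩ := struct0_hyp y1 hy1 a1 (hT y1 hy1) hf hc hc1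
      (hno y1 a1 hy1) (Or.inl h1)
    have hstep : ∀ e ∈ K, ∃ s : F, ∀ w, y1 w = 0 → L w = 0 → ∀ x,
        (L - s • y1) x = e - s * a1 → f (x + w) = f x := by
      intro e he
      have hz : ∀ x, y1 x = a1 → L x = e → f x = 0 := by
        intro x h2 h3
        rw [hfL x h2, hφ, h3]; exact he
      obtain ⟨s, hs⟩ : ∃ s : F, q * (q * (q * cnt (fun x => f x ≠ 0 ∧
          (L - s • y1) x = e - s * a1))) < W := by
        by_contra h
        push Not at h
        have hp := cnt_pencil (fun x => f x ≠ 0) y1 L a1 e (fun x h1 h2 => by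
          simpa using hz x h1 h2)
        have h2 := Nat.mul_le_mul_left q hle
        rw [hp, mul_add, mul_add, mul_add, Finset.mul_sum, Finset.mul_sum, Finset.mul_sum] at h2
        have h4 : ∑ s : F, W ≤ ∑ s : F, q * (q * (q * cnt (fun x => f x ≠ 0 ∧
            (L - s • y1) x = e - s * a1))) :=
          Finset.sum_le_sum fun s _ => h s
        rw [Finset.sum_const, Finset.card_univ, smul_eq_mul, ← hqd] at h4
        have h5 := LB1h y1 hy1 a1 hf hc hc1 (hno y1 a1 hy1)
        rw [← hqd] at h5
        have h6 : 0 < c * Nat.card V := Nat.mul_pos hc1 hNp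
        have h7 := Nat.mul_le_mul_left q h5
        have h8 : 0 < q * (c * Nat.card V) := Nat.mul_pos (by omega) h6
        omega
      have hne := pencil_ne y1 L hL s
      obtain ⟨M', K', φ', -, hK', hfM', hφ'⟩ := struct0_hyp _ hne _ (hT _ hne) hf hc hc1
        (hno _ _ hne) (Or.inl hs)
      refine ⟨s, fun w hw1 hw2 x hx => ?_⟩
      have hw : M' w = 0 := by
        obtain ⟨x0, hx1, hx2⟩ := exists_pt y1 L hy1 hL a1 e
        apply indep_of_zero (n := n) (by omega) hK' hφ' M' x0 w
        intro t
        rw [← hfM' _ (by simp [hx1, hx2, hw1, hw2])]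
        exact hz _ (by simp [hx1, hw1]) (by simp [hx2, hw2])
      rw [hfM' x hx, hfM' (x + w), map_add, hw, add_zero]
      rw [map_add, hx]; simp [hw1, hw2]
    choose! σ hσ using hstep
    have hD : ∀ w, y1 w = 0 → L w = 0 → ∀ x, f (x + w) = f x := by
      intro w hw1 hw2
      have hPD : PD F n (fun x => f (x + w) - f x) :=
        ((hf.translate w).congr (fun x => by rw [add_comm])).sub hf
      rcases PD.fac (Finset.insertNone K)
        (fun i : Option F => i.elim y1 (fun e => L - σ e • y1))
        (fun i : Option F => i.elim a1 (fun e => e - σ e * a1)) n _ hPD (by omega) (by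
        rintro (_ | e) _
        · exact hy1
        · exact pencil_ne y1 L hL _)
        (by
        rintro (_ | e) hi (_ | e') hj hij
        · exact absurd rfl hij
        · obtain ⟨x, h1, h2⟩ := exists_pt y1 L hy1 hL (a1 + 1) (e' + σ e')
          refine ⟨x, ?_, ?_⟩
          · simp [h1, h2]; ring
          · simp [h1]
        · obtain ⟨x, h1, h2⟩ := exists_pt y1 L hy1 hL a1 (e + 1)
          exact ⟨x, by simp [h1], by simp [h1, h2]⟩
        · obtain ⟨x, h1, h2⟩ := exists_pt y1 L hy1 hL a1 e'
          refine ⟨x, by simp [h1, h2], ?_⟩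
          simp only [Option.elim, LinearMap.sub_apply, LinearMap.smul_apply, h1, h2, smul_eq_mul]
          intro h
          apply hij
          rw [sub_left_inj] at h
          rw [h])
        (by
        rintro (_ | e) hi x hx
        · simp only [Option.elim] at hx
          rw [hfL x hx, hfL (x + w) (by simp [hx, hw1]), map_add, hw2, add_zero, sub_self]
        · rw [hσ e (by simpa using hi) w hw1 hw2 x hx, sub_self]) with h | h
      · intro x; exact sub_eq_zero.1 (h x)
      · rw [Finset.card_insertNone] at h; omega
    obtain ⟨u, v, e1, e2, e3, e4⟩ := basis2 y1 L hy1 hL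
    have := bruen_case y1 L u v e1 e2 e3 e4 hf hc hc1 hD hno
    exact absurd this (not_lt.2 hle)

theorem T : Tp F V := T_aux _ V rfl

end A7

set_option linter.unusedSectionVars false

section A8
open scoped Classical
variable {F : Type} [Field F] [Fintype F] {V : Type} [AddCommGroup V] [Module F V] [Finite V]

theorem cnt_in (y : V →ₗ[F] F) (hy : y ≠ 0) (K : Finset F) :
    Fintype.card F * cnt (fun x => y x ∈ K) = K.card * Nat.card V := by
  rw [cnt_fiber (F := F) _ (fun x => y x), Finset.mul_sum]
  calc _ = ∑ a : F, if a ∈ K then Nat.card V else 0 := by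
        refine Finset.sum_congr rfl fun a _ => ?_
        split_ifs with h
        · rw [← cnt_hyp y hy a]
          congr 1
          apply cnt_congr
          intro x
          constructor
          · exact fun h => h.2
          · rintro rfl; exact ⟨h, rfl⟩
        · rw [cnt_zero, mul_zero]
          rintro x ⟨h1, rfl⟩; exact h h1
    _ = _ := by simp

/-- level structure -/
def Lev (y : V →ₗ[F] F) (a0 : F) (n : ℕ) (h : V → F) : Prop :=
  ∀ a, a ≠ a0 → ∃ (M : V →ₗ[F] F) (K : Finset F), (∃ v, y v = 0 ∧ M v = 1) ∧ K.card = n ∧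
    ∀ x, y x = a → (h x = 0 ↔ M x ∈ K)

theorem min_hyper (N y : V →ₗ[F] F) (hN : N ≠ 0) (hy : ∃ v, N v = 0 ∧ y v = 1) (ν a : F)
    {n c : ℕ} {h : V → F} (hh : PD F n h) (hc : n + c = Fintype.card F) (hc1 : 1 ≤ c) (hn : 1 ≤ n)
    (h0 : ∃ x, N x = ν ∧ h x ≠ 0)
    (hle : Fintype.card F * (Fintype.card F * cnt (fun x => h x ≠ 0 ∧ N x = ν)) ≤ c * Nat.card V)
    (hz : ∀ x, N x = ν → y x = a → h x = 0) (w : V) (hw1 : N w = 0) (hw2 : y w = 0)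
    (x : V) (hx : N x = ν) : h (x + w) = h x := by
  obtain ⟨M, K, φ, -, hK, hM, hφ⟩ := struct0_hyp N hN ν T hh hc hc1 h0 (Or.inr ⟨hn, hle⟩)
  have hw : M w = 0 := by
    obtain ⟨x0, hx1, hx2⟩ := exists_pt N y hN hy ν a
    apply indep_of_zero (n := n) (by omega) hK hφ M x0 w
    intro t
    rw [← hM _ (by simp [hx1, hw1])]
    exact hz _ (by simp [hx1, hw1]) (by simp [hx2, hw2])
  rw [hM x hx, hM (x + w) (by simp [hx, hw1]), map_add, hw, add_zero]

def TypeA (c : ℕ) (f : V → F) : Prop :=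
  ∃ (y z : V →ₗ[F] F) (e : F) (K : Finset F), y ≠ 0 ∧ (∃ v, y v = 0 ∧ z v = 1) ∧ K.card = c + 1 ∧
    ∀ x, f x ≠ 0 ↔ y x ∈ K ∧ z x ≠ e

def TypeB (c : ℕ) (f : V → F) : Prop :=
  ∃ (y z : V →ₗ[F] F) (a e : F) (K : Finset F), y ≠ 0 ∧ (∃ v, y v = 0 ∧ z v = 1) ∧
    K.card = c + 1 ∧ ∀ x, f x ≠ 0 ↔ y x ≠ a ∧ ∃ σ ∈ K, z x - e = σ * (y x - a)

def Stage2 (F V : Type) [Field F] [Fintype F] [AddCommGroup V] [Module F V] : Prop :=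
  ∀ (y : V →ₗ[F] F) (a0 : F) (d c : ℕ) (g : V → F), y ≠ 0 → PD F d g → 2 ≤ d → 1 ≤ c →
    d + (c + 1) = Fintype.card F → Lev y a0 d g →
    TypeA c (fun x => (y x - a0) * g x) ∨ TypeB c (fun x => (y x - a0) * g x)

theorem arith1 (b c k q : ℕ) (hc : b + c = q) (hk1 : 1 ≤ k) (hk : k ≤ b)
    (h : (q - k) * (c + k) ≤ (c + 1) * (q - 1)) : k = 1 ∨ k + 1 = b ∨ k = b := by
  by_contra hne
  push Not at hne
  obtain ⟨h1, h2, h3⟩ := hne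
  obtain ⟨i, rfl⟩ := Nat.exists_eq_add_of_le (show 2 ≤ k by omega)
  obtain ⟨j, rfl⟩ := Nat.exists_eq_add_of_le (show (2 + i) + 2 ≤ b by omega)
  have e1 : q - (2 + i) = 2 + j + c := by omega
  have e2 : q - 1 = 3 + i + j + c := by omega
  rw [e1, e2] at h
  nlinarith

theorem forward0 (h2 : Stage2 F V) {b c : ℕ} {f : V → F} (hf : PD F b f)
    (hc : b + c = Fintype.card F) (hc1 : 1 ≤ c) (hb : 2 ≤ b)
    (h : Fintype.card F * (Fintype.card F * cnt (fun x => f x ≠ 0)) =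
      (c + 1) * (Fintype.card F - 1) * Nat.card V) : TypeA c f ∨ TypeB c f := by
  have hN : 0 < Nat.card V := Nat.card_pos
  have hq2 : 1 < Fintype.card F := Fintype.one_lt_card
  have h0 : ∃ x, f x ≠ 0 := by
    by_contra hno
    push Not at hno
    rw [cnt_zero (P := fun x => f x ≠ 0) (by simpa using hno)] at h
    have : 0 < (c + 1) * (Fintype.card F - 1) * Nat.card V :=
      Nat.mul_pos (Nat.mul_pos (by omega) (by omega)) hN
    omega
  obtain ⟨y, a0, hy, hya⟩ := T b c f hf hc hc1 h0 h.le
  obtain ⟨K, g, hk, hg, hfg, hK, hsl, hs⟩ := slice y hy hf hc hc1 h0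
  have haK : a0 ∈ K := (hK a0).2 hya
  have hk1 : 1 ≤ K.card := Finset.card_pos.2 ⟨a0, haK⟩
  have hfg0 : ∀ x, f x ≠ 0 ↔ y x ∈ Kᶜ ∧ g x ≠ 0 := by
    intro x
    rw [hfg, mul_ne_zero_iff, Finset.prod_ne_zero_iff, Finset.mem_compl]
    apply and_congr_left'
    constructor
    · intro h1 h2; exact h1 _ h2 (sub_self _)
    · intro h1 a ha h3; rw [sub_eq_zero] at h3; exact h1 (h3 ▸ ha)
  -- if the support is a union of slices we get a contradiction
  have hslices : ∀ j : ℕ, j = Kᶜ.card → (∀ x, f x ≠ 0 ↔ y x ∈ Kᶜ) →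
      Fintype.card F * j = (c + 1) * (Fintype.card F - 1) := by
    intro j hj hx
    rw [cnt_congr hx, cnt_in y hy, ← hj, ← mul_assoc] at h
    exact Nat.eq_of_mul_eq_mul_right hN h
  have hcc : Kᶜ.card = Fintype.card F - K.card := Finset.card_compl K
  rcases arith1 b c K.card _ hc hk1 hk (le_of_mul_le_mul_right (hs.trans h.le) hN) with hk' | hk' | hk'
  rotate_left
  · left
    rw [show b - K.card = 1 by omega] at hg
    obtain ⟨l, γ, hl⟩ := hg.eq_aff
    by_cases hv : ∃ v, y v = 0 ∧ l v ≠ 0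
    · obtain ⟨v, hv1, hv2⟩ := hv
      refine ⟨y, l, -γ, Kᶜ, hy, ⟨(l v)⁻¹ • v, by simp [hv1], by simp [hv2]⟩, by omega, fun x => ?_⟩
      rw [hfg0, hl, Ne, Ne, eq_neg_iff_add_eq_zero]
    · push Not at hv
      exfalso
      have := hslices (c + 1) (by omega) (fun x => by
        rw [hfg0]
        refine ⟨fun h => h.1, fun hx => ⟨hx, fun hgx => ?_⟩⟩
        have : y x ∉ K := by simpa using hx
        apply this
        rw [hK]
        intro x' hx'
        have e := hv (x' - x) (by simp [hx'])
        rw [hfg, hl]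
        rw [hl] at hgx
        rw [map_sub] at e
        have : l x' + γ = 0 := by linear_combination hgx + e
        rw [this, mul_zero])
      rw [mul_comm] at this
      have := Nat.eq_of_mul_eq_mul_left (by omega) this
      omega
  · exfalso
    rw [show b - K.card = 0 by omega] at hg
    obtain ⟨γ, hl⟩ := hg.eq_const
    have hγ : γ ≠ 0 := by
      rintro rfl
      obtain ⟨x, hx⟩ := h0
      exact hx (by rw [hfg, hl, mul_zero])
    have := hslices c (by omega) (fun x => by
        rw [hfg0, hl]; simp [hγ])
    rw [← hc, show b + c - 1 = (b - 1) + c by omega] at this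
    obtain ⟨j, rfl⟩ := Nat.exists_eq_add_of_le hb
    rw [show 2 + j - 1 = 1 + j by omega] at this
    nlinarith
  · by_cases hb2 : b = 2
    · -- same as the second case
      left
      rw [show b - K.card = 1 by omega] at hg
      obtain ⟨l, γ, hl⟩ := hg.eq_aff
      by_cases hv : ∃ v, y v = 0 ∧ l v ≠ 0
      · obtain ⟨v, hv1, hv2⟩ := hv
        refine ⟨y, l, -γ, Kᶜ, hy, ⟨(l v)⁻¹ • v, by simp [hv1], by simp [hv2]⟩, by omega, fun x => ?_⟩
        rw [hfg0, hl, Ne, Ne, eq_neg_iff_add_eq_zero]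
      · push Not at hv
        exfalso
        have := hslices (c + 1) (by omega) (fun x => by
          rw [hfg0]
          refine ⟨fun h => h.1, fun hx => ⟨hx, fun hgx => ?_⟩⟩
          have : y x ∉ K := by simpa using hx
          apply this
          rw [hK]
          intro x' hx'
          have e := hv (x' - x) (by simp [hx'])
          rw [hfg, hl]
          rw [hl] at hgx
          rw [map_sub] at e
          have : l x' + γ = 0 := by linear_combination hgx + e
          rw [this, mul_zero])
        rw [mul_comm] at this
        have := Nat.eq_of_mul_eq_mul_left (by omega) this
        omega
    · obtain ⟨a1, ha1⟩ := Finset.card_eq_one.1 hk'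
      have : a0 = a1 := by rw [ha1] at haK; simpa using haK
      subst this
      have hf2 : f = fun x => (y x - a0) * g x := by
        funext x; rw [hfg, ha1, Finset.prod_singleton]
      rw [hk'] at hg hsl
      rw [hf2]
      apply h2 y a0 (b - 1) c g hy hg (by omega) hc1 (by omega)
      intro a ha
      have haK' : a ∉ K := by rw [ha1]; simpa using ha
      -- equality in every slice
      have heq : Fintype.card F * (Fintype.card F * cnt (fun x => f x ≠ 0 ∧ y x = a)) ≤
          (c + 1) * Nat.card V := by
        rw [cnt_fiber (F := F) (fun x => f x ≠ 0) (fun x => y x), Finset.mul_sum, Finset.mul_sum,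
          ← Finset.add_sum_erase _ _ (Finset.mem_univ a)] at h
        have h3 : ∑ x ∈ (Kᶜ).erase a, (c + 1) * Nat.card V ≤ ∑ x ∈ Finset.univ.erase a,
            Fintype.card F * (Fintype.card F * cnt (fun z => f z ≠ 0 ∧ y z = x)) :=
          (Finset.sum_le_sum fun i hi => hsl i (by
            have := (Finset.mem_erase.1 hi).2; simpa using this)).trans
          (Finset.sum_le_sum_of_subset (Finset.erase_subset_erase _ (Finset.subset_univ _)))
        rw [Finset.sum_const, Finset.card_erase_of_mem (by simpa using haK'), hcc, hk',
          smul_eq_mul] at h3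
        obtain ⟨j, hj⟩ := Nat.exists_eq_add_of_le (show 2 ≤ Fintype.card F by omega)
        rw [show Fintype.card F - 1 - 1 = j by omega] at h3
        rw [show Fintype.card F - 1 = j + 1 by omega] at h
        nlinarith
      have hgf : cnt (fun x => f x ≠ 0 ∧ y x = a) = cnt (fun x => g x ≠ 0 ∧ y x = a) := by
        apply cnt_congr
        intro x
        rw [hfg0]
        constructor
        · rintro ⟨h1, h2⟩; exact ⟨h1.2, h2⟩
        · rintro ⟨h1, rfl⟩; exact ⟨⟨by simpa using haK', h1⟩, rfl⟩
      rw [hgf] at heq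
      obtain ⟨M, K', φ, hM, hK', hMφ, hφ⟩ := struct0_hyp y hy a T hg
        (show b - 1 + (c + 1) = Fintype.card F by omega) (by omega) (by
          by_contra hno
          apply haK'
          rw [hK]
          intro x hx
          by_contra hfx
          exact hno ⟨x, hx, ((hfg0 x).1 hfx).2⟩) (Or.inr ⟨by omega, heq⟩)
      exact ⟨M, K', hM, hK', fun x hx => by rw [hMφ x hx, hφ]⟩

end A8

set_option linter.unusedSectionVars false

section A9
open scoped Classical
variable {F : Type} [Field F] [Fintype F] {V : Type} [AddCommGroup V] [Module F V] [Finite V]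

theorem cnt_flat_in (y M : V →ₗ[F] F) (hy : y ≠ 0) (hM : ∃ v, y v = 0 ∧ M v = 1) (a : F)
    (K : Finset F) :
    Fintype.card F * (Fintype.card F * cnt (fun x => M x ∈ K ∧ y x = a)) = K.card * Nat.card V := by
  rw [cnt_fiber (F := F) _ (fun x => M x), Finset.mul_sum, Finset.mul_sum]
  calc _ = ∑ t : F, if t ∈ K then Nat.card V else 0 := by
        refine Finset.sum_congr rfl fun t _ => ?_
        split_ifs with h
        · rw [← cnt_flat y M hy hM a t]
          congr 2
          apply cnt_congr
          intro x
          constructor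
          · rintro ⟨⟨h1, h2⟩, h3⟩; exact ⟨h2, h3⟩
          · rintro ⟨h1, rfl⟩; exact ⟨⟨h, h1⟩, rfl⟩
        · rw [cnt_zero, mul_zero, mul_zero]
          rintro x ⟨h1, rfl⟩; exact h h1.1
    _ = _ := by simp

theorem lev_cnt {y : V →ₗ[F] F} (hy : y ≠ 0) {a0 : F} {n c : ℕ} {h : V → F} (hL : Lev y a0 n h)
    (hc : n + c = Fintype.card F) (a : F) (ha : a ≠ a0) :
    Fintype.card F * (Fintype.card F * cnt (fun x => h x ≠ 0 ∧ y x = a)) = c * Nat.card V := by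
  obtain ⟨M, K, hM, hK, hz⟩ := hL a ha
  rw [cnt_congr (Q := fun x => M x ∈ Kᶜ ∧ y x = a), cnt_flat_in y M hy hM, Finset.card_compl, hK]
  · congr 1; omega
  · intro x
    constructor
    · rintro ⟨h1, h2⟩; exact ⟨by rw [Finset.mem_compl, ← hz x h2]; exact h1, h2⟩
    · rintro ⟨h1, h2⟩; exact ⟨by rw [Finset.mem_compl, ← hz x h2] at h1; exact h1, h2⟩

theorem lev_total {y : V →ₗ[F] F} (hy : y ≠ 0) {a0 : F} {n c : ℕ} {h : V → F} (hL : Lev y a0 n h)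
    (hc : n + c = Fintype.card F) :
    Fintype.card F * (Fintype.card F * cnt (fun x => h x ≠ 0)) =
      Fintype.card F * (Fintype.card F * cnt (fun x => h x ≠ 0 ∧ y x = a0)) +
      (Fintype.card F - 1) * (c * Nat.card V) := by
  rw [cnt_fiber (F := F) (fun x => h x ≠ 0) (fun x => y x), Finset.mul_sum, Finset.mul_sum,
    ← Finset.add_sum_erase _ _ (Finset.mem_univ a0)]
  congr 1
  rw [Finset.sum_congr rfl (fun a ha => lev_cnt hy hL hc a (Finset.ne_of_mem_erase ha)),
    Finset.sum_const, Finset.card_erase_of_mem (Finset.mem_univ _), Finset.card_univ, smul_eq_mul]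

/-- the flat `y = a1, M = κ` lies in no zero hyperplane other than possibly `y = a1` -/
def Bad (y M : V →ₗ[F] F) (a1 κ : F) (h : V → F) : Prop :=
  ∀ s : F, ∃ x, (M - s • y) x = κ - s * a1 ∧ h x ≠ 0

theorem bad_bound {y : V →ₗ[F] F} (hy : y ≠ 0) {a0 : F} {n c : ℕ} {h : V → F} (hL : Lev y a0 n h)
    (hh : PD F n h) (hc : n + c = Fintype.card F) (hc1 : 1 ≤ c) {a1 : F} (ha1 : a1 ≠ a0)
    {M : V →ₗ[F] F} (hM : ∃ v, y v = 0 ∧ M v = 1) {κ : F}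
    (hz : ∀ x, y x = a1 → M x = κ → h x = 0) (hb : Bad y M a1 κ h) :
    c ≤ n ∧ (c = n → (∀ x, y x = a0 → h x ≠ 0) ∧
      ∀ s, Fintype.card F * (Fintype.card F * cnt (fun x => h x ≠ 0 ∧ (M - s • y) x = κ - s * a1))
        = c * Nat.card V) := by
  have hN : 0 < Nat.card V := Nat.card_pos
  have hq2 : 1 < Fintype.card F := Fintype.one_lt_card
  have h1 := lev_total hy hL hc
  have h2 := cnt_pencil (fun x => h x ≠ 0) y M a1 κ (fun x h1 h2 => by simpa using hz x h1 h2)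
  rw [h2, mul_add, mul_add, Finset.mul_sum, Finset.mul_sum, lev_cnt hy hL hc a1 ha1] at h1
  have h3 : ∀ s : F, c * Nat.card V ≤ Fintype.card F * (Fintype.card F *
      cnt (fun x => h x ≠ 0 ∧ (M - s • y) x = κ - s * a1)) := fun s =>
    LB1h _ (pencil_ne y M hM s) _ hh hc hc1 (hb s)
  have h4 : ∑ s : F, c * Nat.card V ≤ ∑ s : F, Fintype.card F * (Fintype.card F *
      cnt (fun x => h x ≠ 0 ∧ (M - s • y) x = κ - s * a1)) := Finset.sum_le_sum fun s _ => h3 s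
  have h5 : cnt (fun x => h x ≠ 0 ∧ y x = a0) ≤ cnt (fun x => y x = a0) :=
    cnt_mono fun x hx => hx.2
  have h6 := cnt_hyp y hy a0
  have h7 := Nat.mul_le_mul_left (Fintype.card F) h5
  rw [h6] at h7
  have h8 := Nat.mul_le_mul_left (Fintype.card F) h7
  obtain ⟨j, hj⟩ := Nat.exists_eq_add_of_le (show 1 ≤ Fintype.card F by omega)
  have e1 : Fintype.card F - 1 = j := by omega
  have e2 : (Fintype.card F) * (c * Nat.card V) = c * Nat.card V + j * (c * Nat.card V) := by
    rw [hj]; ring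
  have h4' := h4
  rw [Finset.sum_const, Finset.card_univ, smul_eq_mul, e2] at h4
  rw [e1] at h1
  have h9 : 2 * (c * Nat.card V) ≤ Fintype.card F * Nat.card V := by omega
  have hle : 2 * c ≤ Fintype.card F := by
    rw [← mul_assoc] at h9
    exact le_of_mul_le_mul_right h9 hN
  refine ⟨by omega, fun hcn => ?_⟩
  have e3 : Fintype.card F * Nat.card V = 2 * (c * Nat.card V) := by
    rw [← hc, ← hcn]; ring
  constructor
  · have h10 : Fintype.card F * (Fintype.card F * cnt (fun x => y x = a0)) ≤
        Fintype.card F * (Fintype.card F * cnt (fun x => h x ≠ 0 ∧ y x = a0)) := by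
      rw [h6]; omega
    have h11 := Nat.le_of_mul_le_mul_left h10 (by omega)
    have h12 := Nat.le_of_mul_le_mul_left h11 (by omega)
    intro x hx hx0
    have h13 := cnt_split (fun x => y x = a0) (fun x => h x ≠ 0)
    have h14 := cnt_pos (P := fun x => y x = a0 ∧ ¬ h x ≠ 0) x ⟨hx, by simpa using hx0⟩
    rw [cnt_congr (P := fun x => y x = a0 ∧ h x ≠ 0) (Q := fun x => h x ≠ 0 ∧ y x = a0)
      (fun x => and_comm)] at h13
    omega
  · have h15 : ∑ s : F, c * Nat.card V = ∑ s : F, Fintype.card F * (Fintype.card F *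
      cnt (fun x => h x ≠ 0 ∧ (M - s • y) x = κ - s * a1)) := by
      apply le_antisymm h4'
      rw [Finset.sum_const, Finset.card_univ, smul_eq_mul, e2]
      omega
    intro s
    exact (((Finset.sum_eq_sum_iff_of_le (fun s _ => h3 s)).1 h15) s (Finset.mem_univ _)).symm

theorem split_lemma {y : V →ₗ[F] F} (hy : y ≠ 0) {n c : ℕ} {h : V → F}
    (hh : PD F n h) (hc : n + c = Fintype.card F) (hc1 : 1 ≤ c) {a1 : F} (h0 : ∃ x, h x ≠ 0)
    {M : V →ₗ[F] F} (hM : ∃ v, y v = 0 ∧ M v = 1) {K : Finset F} (hK : K.card = n)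
    (hnb : ∀ κ ∈ K, ¬ Bad y M a1 κ h) :
    ∃ s : F → F, ∀ x, h x = 0 ↔ ∃ κ ∈ K, M x - κ = s κ * (y x - a1) := by
  have h1 : ∀ κ ∈ K, ∃ s : F, ∀ x, (M - s • y) x = κ - s * a1 → h x = 0 := by
    intro κ hκ
    have := hnb κ hκ
    unfold Bad at this
    push Not at this
    exact this
  choose! s hs using h1
  refine ⟨s, ?_⟩
  rcases PD.fac K (fun κ => M - s κ • y) (fun κ => κ - s κ * a1) n h hh (by omega)
    (fun κ _ => pencil_ne y M hM _) (by
      intro i hi j hj hij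
      obtain ⟨x, h1, h2⟩ := exists_pt y M hy hM a1 j
      refine ⟨x, by simp [h1, h2], ?_⟩
      simp only [LinearMap.sub_apply, LinearMap.smul_apply, h1, h2, smul_eq_mul]
      intro h
      rw [sub_left_inj] at h
      exact hij h.symm) (fun κ hκ x hx => hs κ hκ x hx) with h2 | ⟨-, g, hg, hfg⟩
  · obtain ⟨x, hx⟩ := h0
    exact absurd (h2 x) hx
  rw [hK, Nat.sub_self] at hg
  obtain ⟨γ, hγ⟩ := hg.eq_const
  have hγ0 : γ ≠ 0 := by
    rintro rfl
    obtain ⟨x, hx⟩ := h0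
    exact hx (by rw [hfg, hγ, mul_zero])
  intro x
  rw [hfg, hγ, mul_eq_zero, or_iff_left hγ0, Finset.prod_eq_zero_iff]
  refine exists_congr fun κ => and_congr_right fun _ => ?_
  simp only [LinearMap.sub_apply, LinearMap.smul_apply, smul_eq_mul]
  constructor <;> intro h <;> linear_combination h

theorem pencil_lemma {y : V →ₗ[F] F} (hy : y ≠ 0) {n : ℕ} (hn : 1 ≤ n) {h A : V → F} {a0 a1 : F}
    (ha : a1 ≠ a0) {M : V →ₗ[F] F} (hM : ∃ v, y v = 0 ∧ M v = 1) {K : Finset F} (hK : K.card = n)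
    (s : F → F) (hs : ∀ x, h x = 0 ↔ ∃ κ ∈ K, M x - κ = s κ * (y x - a1))
    (hA : PD F 1 A) (hAz : ∀ x, y x = a0 → h x = 0 → A x = 0) (hA0 : ∃ x, y x = a0 ∧ A x ≠ 0) :
    ∃ (θ : F) (S : Finset F), S.card = n ∧
      ∀ x, h x = 0 ↔ ∃ σ ∈ S, M x - θ = σ * (y x - a0) := by
  have hθ : ∀ κ ∈ K, ∀ κ' ∈ K, κ + s κ * (a0 - a1) = κ' + s κ' * (a0 - a1) := by
    intro κ hκ κ' hκ'
    by_contra hne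
    obtain ⟨x, hx, hxA⟩ := hA0
    obtain ⟨v, hv0, hv1⟩ := hM
    apply hxA
    have := hA.roots x v {κ + s κ * (a0 - a1) - M x, κ' + s κ' * (a0 - a1) - M x} (by
      rw [Finset.card_pair (fun h => hne (sub_left_injective h))]; norm_num) (by
      intro t ht
      rw [Finset.mem_insert, Finset.mem_singleton] at ht
      have hyt : y (x + t • v) = a0 := by simp [hx, hv0]
      apply hAz _ hyt
      rw [hs]
      rcases ht with ht | ht
      · refine ⟨κ, hκ, ?_⟩
        rw [hyt, ht]; simp [hv1]
      · refine ⟨κ', hκ', ?_⟩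
        rw [hyt, ht]; simp [hv1]) 0
    simpa using this
  obtain ⟨κ0, hκ0⟩ : K.Nonempty := Finset.card_pos.1 (by omega)
  refine ⟨κ0 + s κ0 * (a0 - a1), K.image s, ?_, ?_⟩
  · rw [Finset.card_image_of_injOn, hK]
    intro κ hκ κ' hκ' he
    have := hθ κ hκ κ' hκ'
    rw [he] at this
    exact add_right_cancel this
  · intro x
    rw [hs]
    constructor
    · rintro ⟨κ, hκ, h1⟩
      refine ⟨s κ, Finset.mem_image_of_mem _ hκ, ?_⟩
      rw [← hθ κ hκ κ0 hκ0]
      linear_combination h1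
    · rintro ⟨σ, hσ, h1⟩
      obtain ⟨κ, hκ, rfl⟩ := Finset.mem_image.1 hσ
      refine ⟨κ, hκ, ?_⟩
      rw [← hθ κ hκ κ0 hκ0] at h1
      linear_combination h1

end A9

set_option linter.unusedSectionVars false

section A10
open scoped Classical
variable {F : Type} [Field F] [Fintype F] {V : Type} [AddCommGroup V] [Module F V] [Finite V]

theorem bad_pair {y : V →ₗ[F] F} (hy : y ≠ 0) {a0 : F} {d : ℕ} (hd : 1 ≤ d) {g u : V → F}
    (hdd : d + d = Fintype.card F) (hg : PD F d g) (hu : PD F d u) (hLg : Lev y a0 d g)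
    (hLu : Lev y a0 d u) (hgu : ∀ x, y x ≠ a0 → (u x = 0 ↔ g x ≠ 0)) {a a' : F} (ha : a ≠ a0)
    (ha' : a' ≠ a0) (haa : a ≠ a') {M M' : V →ₗ[F] F} (hM : ∃ v, y v = 0 ∧ M v = 1)
    (hM' : ∃ v, y v = 0 ∧ M' v = 1) {K : Finset F} (hK : K.card = d)
    (hz : ∀ x, y x = a → (g x = 0 ↔ M x ∈ K)) {κ κ' : F} (hκ : κ ∈ K)
    (hz' : ∀ x, y x = a' → M' x = κ' → u x = 0)
    (hb : Bad y M a κ g) (hb' : Bad y M' a' κ' u) : False := by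
  have hN : 0 < Nat.card V := Nat.card_pos
  have hq2 : 1 < Fintype.card F := Fintype.one_lt_card
  obtain ⟨hg1, hg2⟩ := (bad_bound hy hLg hg hdd hd ha hM
    (fun x h1 h2 => (hz x h1).2 (h2 ▸ hκ)) hb).2 rfl
  obtain ⟨hu1, hu2⟩ := (bad_bound hy hLu hu hdd hd ha' hM' hz' hb').2 rfl
  obtain ⟨u0, v0, e1, e2, e3, e4⟩ := basis2 y M' hy hM'
  -- invariance of u
  have hinv : ∀ w, y w = 0 → M' w = 0 → ∀ x, y x ≠ a' → u (x + w) = u x := by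
    intro w hw1 hw2 x hx
    set s := (M' x - κ') / (y x - a') with hs
    have hsx : s * (y x - a') = M' x - κ' := div_mul_cancel₀ _ (sub_ne_zero.2 hx)
    refine min_hyper (M' - s • y) y (pencil_ne y M' hM' s) ⟨u0 + s • v0, ?_, ?_⟩ (κ' - s * a') a'
      hu hdd hd hd (hb' s) (hu2 s).le ?_ w ?_ hw1 x ?_
    · simp [e1, e2, e3, e4]
    · simp [e1, e2]
    · intro x' h1 h2
      apply hz' x' h2
      simp only [LinearMap.sub_apply, LinearMap.smul_apply, smul_eq_mul, h2] at h1
      linear_combination h1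
    · simp [hw1, hw2]
    · simp only [LinearMap.sub_apply, LinearMap.smul_apply, smul_eq_mul]
      linear_combination -hsx
  have hMD : ∀ w, y w = 0 → M' w = 0 → M w = 0 := by
    intro w hw1 hw2
    by_contra hMw
    obtain ⟨x, hx1, hx2⟩ := exists_pt y M hy hM a κ
    have hgx : g x = 0 := (hz x hx1).2 (hx2 ▸ hκ)
    have hux : u x ≠ 0 := fun h => ((hgu x (hx1 ▸ ha)).1 h) hgx
    obtain ⟨t, ht⟩ : ∃ t, t ∉ K := by
      by_contra hall
      push Not at hall
      have : K = Finset.univ := Finset.eq_univ_iff_forall.2 hall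
      rw [this, Finset.card_univ] at hK
      omega
    have hyx : y (x + ((t - κ) / M w) • w) = a := by simp [hx1, hw1]
    have h1 : g (x + ((t - κ) / M w) • w) ≠ 0 := by
      intro h
      rw [hz _ hyx] at h
      apply ht
      rwa [map_add, map_smul, smul_eq_mul, div_mul_cancel₀ _ hMw, hx2, add_sub_cancel] at h
    have h2 := (hgu _ (hyx ▸ ha)).2 h1
    rw [hinv _ (by simp [hw1]) (by simp [hw2]) x (hx1 ▸ haa)] at h2
    exact hux h2
  have hMeq : ∀ x, M x = M u0 * y x + M v0 * M' x := by
    intro x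
    have := hMD (x - (y x • u0 + M' x • v0)) (by simp [e1, e2]) (by simp [e3, e4])
    simp only [map_sub, map_add, map_smul, smul_eq_mul] at this
    linear_combination this
  have hα : M v0 ≠ 0 := by
    intro h
    obtain ⟨v, hv1, hv2⟩ := hM
    rw [hMeq, hv1, h] at hv2
    simp at hv2
  -- the common hyperplane
  set κ2 := (κ - M u0 * a) / M v0 with hκ2
  have hκ2' : M v0 * κ2 = κ - M u0 * a := mul_div_cancel₀ _ hα
  set s := (κ2 - κ') / (a - a') with hs
  have hs' : s * (a - a') = κ2 - κ' := div_mul_cancel₀ _ (sub_ne_zero.2 haa)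
  have hiff : ∀ x, (M - (M v0 * s + M u0) • y) x = κ - (M v0 * s + M u0) * a ↔
      (M' - s • y) x = κ' - s * a' := by
    intro x
    simp only [LinearMap.sub_apply, LinearMap.smul_apply, smul_eq_mul, hMeq x]
    constructor
    · intro h
      apply mul_left_cancel₀ hα
      linear_combination h - hκ2' - M v0 * hs'
    · intro h
      linear_combination M v0 * h + hκ2' + M v0 * hs'
  have c1 := hg2 (M v0 * s + M u0)
  have c2 := hu2 s
  rw [cnt_congr (fun x => and_congr_right fun _ => hiff x)] at c1
  have c3 := cnt_hyp (M' - s • y) (pencil_ne y M' hM' s) (κ' - s * a')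
  set P : V → Prop := fun x => (M' - s • y) x = κ' - s * a' with hP
  have c4 : cnt (fun x => u x ≠ 0 ∧ P x) =
      cnt (fun x => P x ∧ y x = a0) + cnt (fun x => P x ∧ y x ≠ a0 ∧ g x = 0) := by
    rw [cnt_split _ (fun x => y x = a0)]
    congr 1
    · apply cnt_congr
      intro x
      constructor
      · rintro ⟨⟨h1, h2⟩, h3⟩; exact ⟨h2, h3⟩
      · rintro ⟨h1, h2⟩; exact ⟨⟨hu1 x h2, h1⟩, h2⟩
    · apply cnt_congr
      intro x
      have := hgu x
      tauto
  have c5 : cnt P = cnt (fun x => g x ≠ 0 ∧ P x) + cnt (fun x => P x ∧ y x ≠ a0 ∧ g x = 0) := by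
    rw [cnt_split P (fun x => g x ≠ 0)]
    congr 1
    · exact cnt_congr fun x => and_comm
    · apply cnt_congr
      intro x
      have := hg1 x
      tauto
  have c6 : 0 < cnt (fun x => P x ∧ y x = a0) := by
    obtain ⟨x, hx1, hx2⟩ := exists_pt y M' hy hM' a0 (κ' - s * a' + s * a0)
    refine cnt_pos x ⟨?_, hx1⟩
    simp [hP, hx1, hx2]
  have c7 : Fintype.card F * (Fintype.card F * (cnt (fun x => g x ≠ 0 ∧ P x) +
      cnt (fun x => u x ≠ 0 ∧ P x))) = Fintype.card F * (Fintype.card F * cnt P) := by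
    rw [mul_add, mul_add, c1, c2, c3, ← hdd]; ring
  have c8 := Nat.eq_of_mul_eq_mul_left (by omega) c7
  have c9 := Nat.eq_of_mul_eq_mul_left (by omega) c8
  omega

end A10

set_option linter.unusedSectionVars false

section A11
open scoped Classical
open Polynomial
variable {F : Type} [Field F] [Fintype F] {V : Type} [AddCommGroup V] [Module F V] [Finite V]

theorem cnt_union_le {ι : Type} {V : Type} [Finite V] (I : Finset ι) (P : V → Prop)
    (Q : ι → V → Prop) (h : ∀ x, P x → ∃ i ∈ I, Q i x) : cnt P ≤ ∑ i ∈ I, cnt (Q i) := by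
  cases nonempty_fintype V
  rw [cnt_eq]
  calc _ ≤ (I.biUnion (fun i => Finset.univ.filter (Q i))).card := by
        apply Finset.card_le_card
        intro x hx
        rw [Finset.mem_filter] at hx
        obtain ⟨i, hi, hq⟩ := h x hx.2
        rw [Finset.mem_biUnion]
        exact ⟨i, hi, by simpa using hq⟩
    _ ≤ _ := Finset.card_biUnion_le
    _ = _ := Finset.sum_congr rfl fun i _ => (cnt_eq _).symm

theorem exists_good (y : V →ₗ[F] F) (hy : y ≠ 0) (a0 : F) (M : F → V →ₗ[F] F)
    (hM : ∀ a, a ≠ a0 → ∃ v, y v = 0 ∧ M a v = 1) :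
    ∃ v, y v = 0 ∧ ∀ a, a ≠ a0 → M a v ≠ 0 := by
  by_contra hno
  push Not at hno
  have hN : 0 < Nat.card V := Nat.card_pos
  have hq2 : 1 < Fintype.card F := Fintype.one_lt_card
  have h1 := cnt_union_le (Finset.univ.erase a0) (fun x => y x = 0) (fun a x => y x = 0 ∧ M a x = 0)
    (by
      intro x hx
      obtain ⟨a, ha, h⟩ := hno x hx
      exact ⟨a, by simpa using ha, hx, h⟩)
  have h2 := Nat.mul_le_mul_left (Fintype.card F) (Nat.mul_le_mul_left (Fintype.card F) h1)
  rw [cnt_hyp y hy, Finset.mul_sum, Finset.mul_sum, Finset.sum_congr rfl (fun a ha =>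
    cnt_flat y (M a) hy (hM a (Finset.ne_of_mem_erase ha)) 0 0), Finset.sum_const,
    Finset.card_erase_of_mem (Finset.mem_univ _), Finset.card_univ, smul_eq_mul] at h2
  have := le_of_mul_le_mul_right h2 hN
  omega

theorem no_double {p u : F[X]} (h : p * u = ∏ a : F, (X - C a)) (t : F) (h1 : p.eval t = 0) :
    u.eval t ≠ 0 := by
  intro h2
  have hs : (∏ a : F, (X - C a)).Separable := by
    rw [separable_prod_X_sub_C_iff]; exact fun a b h => h
  have hd : (X - C t) * (X - C t) ∣ ∏ a : F, (X - C a) := by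
    rw [← h]
    exact mul_dvd_mul (dvd_iff_isRoot.2 h1) (dvd_iff_isRoot.2 h2)
  exact not_isUnit_X_sub_C t (hs.squarefree _ hd)

theorem construct_u (y : V →ₗ[F] F) (hy : y ≠ 0) (a0 : F) {d e : ℕ} (hde : d + e = Fintype.card F)
    (hd : 1 ≤ d) (he : 1 ≤ e) {g : V → F} (hg : PD F d g) (hL : Lev y a0 d g) :
    ∃ u A : V → F, PD F e u ∧ PD F 1 A ∧ (∀ x, y x ≠ a0 → (u x = 0 ↔ g x ≠ 0)) ∧
      (∀ x, y x = a0 → g x * u x = A x) ∧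
      ((∀ x, y x = a0 → A x = 0) → ∀ x, y x = a0 → (u x = 0 ↔ g x ≠ 0)) := by
  choose! M K hM hK hz using hL
  obtain ⟨v, hyv, hMv⟩ := exists_good y hy a0 M hM
  obtain ⟨a1, ha1⟩ : ∃ a1, a1 ≠ a0 := exists_ne a0
  obtain ⟨P, hP, hPe⟩ := hg.taylor v
  -- roots on lines
  let Tr : V → Finset F := fun x => (K (y x)).image (fun k => (k - M (y x) x) / M (y x) v)
  have hTc : ∀ x, y x ≠ a0 → (Tr x).card = d := by
    intro x hx
    rw [Finset.card_image_of_injective, hK _ hx]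
    intro k k' h
    have := hMv _ hx
    field_simp at h
    exact sub_left_injective h
  have hTz : ∀ x, y x ≠ a0 → ∀ t ∈ Tr x, g (x + t • v) = 0 := by
    intro x hx t ht
    obtain ⟨k, hk, rfl⟩ := Finset.mem_image.1 ht
    rw [hz (y x) hx _ (by simp [hyv])]
    rw [map_add, map_smul, smul_eq_mul, div_mul_cancel₀ _ (hMv _ hx), add_sub_cancel]
    exact hk
  have hlow : ∀ (R : F[X]), (∀ k, d ≤ k → R.coeff k = 0) → ∀ S : Finset F, d ≤ S.card →
      (∀ t ∈ S, R.eval t = 0) → R = 0 := by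
    intro R hR S hS hRS
    apply Polynomial.eq_zero_of_natDegree_lt_card_of_eval_eq_zero' _ S hRS
    have : R.natDegree ≤ d - 1 := by
      rw [natDegree_le_iff_coeff_eq_zero]
      intro k hk
      exact hR k (by omega)
    omega
  have hc0 := (hP d).1 le_rfl
  rw [Nat.sub_self] at hc0
  obtain ⟨α, hα⟩ := hc0.eq_const
  have hα0 : α ≠ 0 := by
    rintro rfl
    obtain ⟨x, hx⟩ := exists_val y hy a1
    have hx0 : y x ≠ a0 := hx ▸ ha1
    have h1 : ev x P = 0 := by
      apply hlow _ _ (Tr x) (hTc x hx0).ge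
      · intro t ht; rw [← hPe]; exact hTz x hx0 t ht
      · intro k hk
        rcases hk.eq_or_lt with rfl | hk
        · rw [ev_coeff, hα]
        · rw [ev_coeff, (hP k).2 hk]; rfl
    have h2 : K (y x) = Finset.univ := by
      ext k
      simp only [Finset.mem_univ, iff_true]
      have h3 := (hz (y x) hx0 (x + ((k - M (y x) x) / M (y x) v) • v) (by simp [hyv])).1 (by
        rw [hPe, h1]; simp)
      rwa [map_add, map_smul, smul_eq_mul, div_mul_cancel₀ _ (hMv _ hx0), add_sub_cancel] at h3
    have h4 := hK (y x) hx0
    rw [h2, Finset.card_univ] at h4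
    omega
  -- monic version
  set P' : Polynomial (V → F) := C (fun _ => α⁻¹) * P with hP'
  have hP'T : TD d P' := by
    have := TD.CX (n := 0) (j := 0) (c := (fun _ => α⁻¹ : V → F)) (PD.const _ _) le_rfl
    have := this.mul hP
    simpa [hP'] using this
  have hP'1 : P'.coeff d = 1 := by
    funext x
    rw [hP', coeff_C_mul, Pi.mul_apply, hα]
    simp [hα0]
  have hP'e : ∀ x t, (ev x P').eval t = α⁻¹ * g (x + t • v) := by
    intro x t
    rw [hP', map_mul, ev_C, eval_mul, eval_C, hPe]
  obtain ⟨U, R, hD, hU, hR, hRd⟩ := hP'T.div hP'1 (show d ≤ Fintype.card F by omega)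
    (Fintype.card F + 1) (D0 F V) D0_TD (fun k hk => (D0_TD k).2 (by omega))
  have hDx : ∀ x, ev x P' * ev x U + ev x R = ∏ a : F, (X - C a) := by
    intro x; rw [← ev_D0 (V := V) x, hD, map_add, map_mul (ev x) P' U]
  have hD0e : ∀ t : F, (∏ a : F, (X - C a)).eval t = 0 := by
    intro t
    rw [eval_prod, Finset.prod_eq_zero (Finset.mem_univ t)]
    simp
  have hRlow : ∀ x k, d ≤ k → (ev x R).coeff k = 0 := by
    intro x k hk; rw [ev_coeff, hRd k hk]; rfl
  set χ : V →ₗ[F] F := (M a1 v)⁻¹ • M a1 with hχ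
  have hχv : χ v = 1 := by simp [hχ, hMv a1 ha1]
  set φ : V →ₗ[F] V := LinearMap.id - χ.smulRight v with hφ
  have hφx : ∀ x, φ x = x - χ x • v := fun x => rfl
  have hφb : ∀ x, φ x + χ x • v = x := fun x => by rw [hφx]; abel
  have hyφ : ∀ x, y (φ x) = y x := fun x => by rw [hφx]; simp [hyv]
  have hu : PD F e (fun x => (ev (φ x) U).eval (χ x)) := by
    have := hU.subst φ 0 χ 0
    rw [show Fintype.card F - d = e by omega] at this
    exact this.congr (by simp)
  have hr : PD F (Fintype.card F) (fun x => (ev (φ x) R).eval (χ x)) :=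
    (hR.subst φ 0 χ 0).congr (by simp)
  have hR0 : ∀ x, y x ≠ a0 → ev (φ x) R = 0 := by
    intro x hx
    have hx' : y (φ x) ≠ a0 := by rwa [hyφ]
    apply hlow _ (hRlow _) (Tr (φ x)) (hTc _ hx').ge
    intro t ht
    have := congrArg (eval t) (hDx (φ x))
    rw [hD0e, eval_add, eval_mul, hP'e, hTz _ hx' t ht] at this
    simpa using this
  have hrel : ∀ x, ev (φ x) R = 0 → ((ev (φ x) U).eval (χ x) = 0 ↔ g x ≠ 0) := by
    intro x hx
    have h1 := hDx (φ x)
    rw [hx, add_zero] at h1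
    have h2 := congrArg (eval (χ x)) h1
    rw [hD0e, eval_mul] at h2
    have h3 := hP'e (φ x) (χ x)
    rw [hφb] at h3
    constructor
    · intro h4 h5
      rw [h5, mul_zero] at h3
      exact no_double h1 _ h3 h4
    · intro h4
      rcases mul_eq_zero.1 h2 with h5 | h5
      · rw [h5] at h3
        exact absurd (mul_eq_zero.1 h3.symm) (by simp [hα0, h4])
      · exact h5
  obtain ⟨A, hA, hAr⟩ := PD.affOn y hy a0 hr (fun x hx => by rw [hR0 x hx]; simp)
  refine ⟨_, fun x => (-α) * A x, hu, hA.smul _, fun x hx => hrel x (hR0 x hx), ?_, ?_⟩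
  · intro x hx
    simp only
    rw [← hAr x hx]
    have h2 := congrArg (eval (χ x)) (hDx (φ x))
    rw [hD0e, eval_add, eval_mul, hP'e, hφb] at h2
    have h3 : α * α⁻¹ = 1 := mul_inv_cancel₀ hα0
    linear_combination α * h2 - g x * (ev (φ x) U).eval (χ x) * h3
  · intro hA0 x hx
    apply hrel
    apply hlow _ (hRlow _) Finset.univ (by rw [Finset.card_univ]; omega)
    intro t _
    have hφ2 : φ (φ x + t • v) = φ x := by
      simp only [hφx, map_add, map_sub, map_smul, hχv, smul_eq_mul, add_smul, sub_smul, mul_one]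
      abel
    have hχ2 : χ (φ x + t • v) = t := by simp [hφx, hχv]
    have hy2 : y (φ x + t • v) = a0 := by simp [hyφ, hyv, hx]
    have h1 := hAr _ hy2
    simp only [hφ2, hχ2] at h1
    rw [h1]
    have := hA0 _ hy2
    simpa [hα0] using this

end A11

set_option linter.unusedSectionVars false

section A12
open scoped Classical
variable {F : Type} [Field F] [Fintype F] {V : Type} [AddCommGroup V] [Module F V] [Finite V]

theorem lev_compl {y : V →ₗ[F] F} {a0 : F} {d e : ℕ} (hde : d + e = Fintype.card F) {g u : V → F}
    (hL : Lev y a0 d g) (hgu : ∀ x, y x ≠ a0 → (u x = 0 ↔ g x ≠ 0)) : Lev y a0 e u := by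
  intro a ha
  obtain ⟨M, K, hM, hK, hz⟩ := hL a ha
  refine ⟨M, Kᶜ, hM, by rw [Finset.card_compl, hK]; omega, fun x hx => ?_⟩
  rw [hgu x (hx ▸ ha), Finset.mem_compl, ← hz x hx]

theorem lev_ne {y : V →ₗ[F] F} (hy : y ≠ 0) {a0 : F} {n : ℕ} (hn : n < Fintype.card F) {h : V → F}
    (hL : Lev y a0 n h) {a : F} (ha : a ≠ a0) : ∃ x, y x = a ∧ h x ≠ 0 := by
  obtain ⟨M, K, hM, hK, hz⟩ := hL a ha
  obtain ⟨t, ht⟩ : ∃ t, t ∉ K := by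
    by_contra hall
    push Not at hall
    rw [Finset.eq_univ_iff_forall.2 hall, Finset.card_univ] at hK
    omega
  obtain ⟨x, h1, h2⟩ := exists_pt y M hy hM a t
  exact ⟨x, h1, fun h => ht (h2 ▸ (hz x h1).1 h)⟩

theorem not_split {y : V →ₗ[F] F} {a0 : F} {n : ℕ} {h : V → F} (hL : Lev y a0 n h) (hy : y ≠ 0)
    {c : ℕ} (hh : PD F n h) (hc : n + c = Fintype.card F) (hc1 : 1 ≤ c)
    (hn : ¬ ∃ (M : V →ₗ[F] F) (K : Finset F) (a1 : F) (s : F → F), a1 ≠ a0 ∧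
      (∃ v, y v = 0 ∧ M v = 1) ∧ K.card = n ∧
      ∀ x, h x = 0 ↔ ∃ κ ∈ K, M x - κ = s κ * (y x - a1)) :
    ∀ a, a ≠ a0 → ∃ (M : V →ₗ[F] F) (K : Finset F) (κ : F), (∃ v, y v = 0 ∧ M v = 1) ∧ K.card = n ∧
      (∀ x, y x = a → (h x = 0 ↔ M x ∈ K)) ∧ κ ∈ K ∧ Bad y M a κ h := by
  intro a ha
  obtain ⟨x, -, hx⟩ := lev_ne hy (by omega) hL ha
  obtain ⟨M, K, hM, hK, hz⟩ := hL a ha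
  by_contra hno
  apply hn
  obtain ⟨s, hs⟩ := split_lemma (a1 := a) hy hh hc hc1 ⟨x, hx⟩ hM hK (fun κ hκ hb =>
    hno ⟨M, K, κ, hM, hK, hz, hκ, hb⟩)
  exact ⟨M, K, a, s, ha, hM, hK, hs⟩

theorem stage2 : Stage2 F V := by
  intro y a0 d c g hy hg hd hc1 hdc hL
  have hN : 0 < Nat.card V := Nat.card_pos
  have hq2 : 1 < Fintype.card F := Fintype.one_lt_card
  obtain ⟨u, A, hu, hA, hgu, hguA, hA0⟩ := construct_u y hy a0 hdc (by omega) (by omega) hg hL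
  have hLu := lev_compl hdc hL hgu
  obtain ⟨a1, ha1⟩ : ∃ a1, a1 ≠ a0 := exists_ne a0
  by_cases hAz : ∀ x, y x = a0 → A x = 0
  · left
    have hall : ∀ x, u x = 0 ↔ g x ≠ 0 := by
      intro x
      by_cases hx : y x = a0
      · exact hA0 hAz x hx
      · exact hgu x hx
    obtain ⟨xg, hxg1, hxg⟩ := lev_ne hy (by omega) hL ha1
    obtain ⟨xu, -, hxu⟩ := lev_ne hy (by omega) hLu ha1
    have h1 := LB1 (c + 1) d u hu (by omega) (by omega) ⟨xu, hxu⟩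
    have h2 := cnt_split (fun _ : V => True) (fun x => g x ≠ 0)
    rw [cnt_true] at h2
    rw [cnt_congr (Q := fun x => g x ≠ 0) (by simp),
      cnt_congr (P := fun x => True ∧ ¬ g x ≠ 0) (Q := fun x => u x ≠ 0) (fun x => by
        have := hall x; tauto)] at h2
    have h3 : Fintype.card F * cnt (fun x => g x ≠ 0) ≤ (c + 1) * Nat.card V := by
      have e1 : Fintype.card F * Nat.card V = Fintype.card F * cnt (fun x => g x ≠ 0) +
          Fintype.card F * cnt (fun x => u x ≠ 0) := by
        rw [← mul_add, ← h2]
      have e2 : Fintype.card F * Nat.card V = d * Nat.card V + (c + 1) * Nat.card V := by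
        rw [← hdc, add_mul]
      omega
    obtain ⟨M, K, φ, hM, hK, hMφ, hφ⟩ := struct0 T hg hdc (by omega) ⟨xg, hxg⟩
      (Or.inr ⟨by omega, h3⟩)
    have hind : ∃ v, y v = 0 ∧ M v = 1 := by
      by_contra hno
      have hv : ∀ v, y v = 0 → M v = 0 := by
        intro v hv
        by_contra hMv
        exact hno ⟨(M v)⁻¹ • v, by simp [hv], by simp [hMv]⟩
      obtain ⟨p, hp⟩ := exists_one y hy
      have hMy : ∀ x, M x = M p * y x := by
        intro x
        have := hv (x - y x • p) (by simp [hp])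
        simp only [map_sub, map_smul, smul_eq_mul] at this
        linear_combination this
      have hMp : M p ≠ 0 := by
        intro h
        apply hM
        ext x
        rw [hMy, h]; simp
      obtain ⟨t, ht, hta⟩ : ∃ t ∈ K, t ≠ M p * a0 := Finset.exists_mem_ne (by omega) _
      obtain ⟨x, hx1, hx2⟩ := lev_ne hy (by omega) hL (a := t / M p) (by
        intro h; apply hta; rw [← h, mul_div_cancel₀ _ hMp])
      apply hx2
      rw [hMφ, hφ, hMy, hx1, mul_div_cancel₀ _ hMp]
      exact ht
    obtain ⟨u0, v0, e1, e2, e3, e4⟩ := basis2 y M hy hind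
    refine ⟨M, y, a0, Kᶜ, hM, ⟨u0, e3, e1⟩, by rw [Finset.card_compl, hK]; omega, fun x => ?_⟩
    rw [mul_ne_zero_iff, sub_ne_zero, Finset.mem_compl, ← hφ, ← hMφ]
    tauto
  right
  push Not at hAz
  by_cases hsg : ∃ (M : V →ₗ[F] F) (K : Finset F) (a1 : F) (s : F → F), a1 ≠ a0 ∧
      (∃ v, y v = 0 ∧ M v = 1) ∧ K.card = d ∧
      ∀ x, g x = 0 ↔ ∃ κ ∈ K, M x - κ = s κ * (y x - a1)
  · obtain ⟨M, K, a1, s, ha1, hM, hK, hs⟩ := hsg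
    obtain ⟨θ, S, hS, hgS⟩ := pencil_lemma hy (by omega) ha1 hM hK s hs hA
      (fun x h1 h2 => by rw [← hguA x h1, h2, zero_mul]) hAz
    refine ⟨y, M, a0, θ, Sᶜ, hy, hM, by rw [Finset.card_compl, hS]; omega, fun x => ?_⟩
    rw [mul_ne_zero_iff, sub_ne_zero]
    apply and_congr_right
    intro hx
    rw [Ne, hgS]
    have hx' : y x - a0 ≠ 0 := sub_ne_zero.2 hx
    constructor
    · intro h
      refine ⟨(M x - θ) / (y x - a0), ?_, (div_mul_cancel₀ _ hx').symm⟩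
      rw [Finset.mem_compl]
      intro h2
      exact h ⟨_, h2, (div_mul_cancel₀ _ hx').symm⟩
    · rintro ⟨σ, hσ, h1⟩ ⟨τ, hτ, h2⟩
      rw [h1] at h2
      rw [mul_right_cancel₀ hx' h2, Finset.mem_compl] at hσ
      exact hσ hτ
  by_cases hsu : ∃ (M : V →ₗ[F] F) (K : Finset F) (a1 : F) (s : F → F), a1 ≠ a0 ∧
      (∃ v, y v = 0 ∧ M v = 1) ∧ K.card = c + 1 ∧
      ∀ x, u x = 0 ↔ ∃ κ ∈ K, M x - κ = s κ * (y x - a1)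
  · obtain ⟨M, K, a1, s, ha1, hM, hK, hs⟩ := hsu
    obtain ⟨θ, S, hS, hgS⟩ := pencil_lemma hy (by omega) ha1 hM hK s hs hA
      (fun x h1 h2 => by rw [← hguA x h1, h2, mul_zero]) hAz
    refine ⟨y, M, a0, θ, S, hy, hM, hS, fun x => ?_⟩
    rw [mul_ne_zero_iff, sub_ne_zero]
    apply and_congr_right
    intro hx
    rw [← hgu x hx, hgS]
  exfalso
  have hbg := not_split hL hy hg hdc (by omega) hsg
  have hbu := not_split hLu hy hu (show c + 1 + d = Fintype.card F by omega) (by omega) hsu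
  obtain ⟨a2, ha2, ha21⟩ : ∃ a2, a2 ≠ a0 ∧ a2 ≠ a1 := by
    by_contra hno
    push Not at hno
    have : (Finset.univ : Finset F) ⊆ {a0, a1} := by
      intro x _
      rw [Finset.mem_insert, Finset.mem_singleton]
      by_cases hx : x = a0
      · exact Or.inl hx
      · exact Or.inr (hno x hx)
    have := (Finset.card_le_card this).trans Finset.card_le_two
    rw [Finset.card_univ] at this
    omega
  obtain ⟨M, K, κ, hM, hK, hz, hκ, hb⟩ := hbg a2 ha2
  obtain ⟨M', K', κ', hM', hK', hz', hκ', hb'⟩ := hbu a1 ha1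
  have b1 := (bad_bound hy hL hg hdc (by omega) ha2 hM
    (fun x h1 h2 => (hz x h1).2 (h2 ▸ hκ)) hb).1
  have b2 := (bad_bound hy hLu hu (show c + 1 + d = Fintype.card F by omega) (by omega) ha1 hM'
    (fun x h1 h2 => (hz' x h1).2 (h2 ▸ hκ')) hb').1
  have hcd : c + 1 = d := by omega
  rw [hcd] at hu hLu hdc
  exact bad_pair hy (by omega) hdc hg hu hL hLu hgu ha2 ha1 ha21 hM hM' hK hz hκ
    (fun x h1 h2 => (hz' x h1).2 (h2 ▸ hκ')) hb hb'

theorem forward {b c : ℕ} {f : V → F} (hf : PD F b f)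
    (hc : b + c = Fintype.card F) (hc1 : 1 ≤ c) (hb : 2 ≤ b)
    (h : Fintype.card F * (Fintype.card F * cnt (fun x => f x ≠ 0)) =
      (c + 1) * (Fintype.card F - 1) * Nat.card V) : TypeA c f ∨ TypeB c f :=
  forward0 stage2 hf hc hc1 hb h

end A12

set_option linter.unusedSectionVars false

section A13
open scoped Classical
variable {F : Type} [Field F] [Fintype F] {m : ℕ}

theorem ncard_aff (H : AffineSubspace F (Fin m → F)) (hH : (H : Set (Fin m → F)).Nonempty) {k : ℕ}
    (hk : Module.finrank F H.direction = k) :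
    (H : Set (Fin m → F)).ncard = Fintype.card F ^ k := by
  obtain ⟨p, hp⟩ := hH
  have e : (H : Set (Fin m → F)) = (fun v => v + p) '' (H.direction : Set (Fin m → F)) := by
    ext x
    simp only [Set.mem_image, SetLike.mem_coe]
    constructor
    · intro hx
      exact ⟨x - p, AffineSubspace.vsub_mem_direction hx hp, by simp⟩
    · rintro ⟨v, hv, rfl⟩
      exact AffineSubspace.vadd_mem_of_mem_direction hv hp
  rw [e, Set.ncard_image_of_injective _ (fun a b h => by simpa using h)]
  have : Set.ncard (H.direction : Set (Fin m → F)) = Nat.card H.direction := rfl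
  rw [this, Module.natCard_eq_pow_finrank (K := F), hk, Nat.card_eq_fintype_card]

theorem ncard_iUnion_eq {V ι : Type*} [Finite V] (L : Finset ι) (X : ι → Set V) (n : ℕ)
    (hn : ∀ i ∈ L, (X i).ncard = n) (hd : ∀ i ∈ L, ∀ j ∈ L, i ≠ j → Disjoint (X i) (X j)) :
    (⋃ i ∈ L, X i).ncard = L.card * n := by
  induction L using Finset.induction_on with
  | empty => simp
  | insert a s ha ih =>
    rw [Finset.set_biUnion_insert, Set.ncard_union_eq, ih, hn a (by simp), Finset.card_insert_of_notMem ha]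
    · ring
    · exact fun i hi => hn i (by simp [hi])
    · exact fun i hi j hj => hd i (by simp [hi]) j (by simp [hj])
    · rw [Set.disjoint_iUnion₂_right]
      intro i hi
      exact hd a (by simp) i (by simp [hi]) (by rintro rfl; exact ha hi)

theorem hyper_sup {D1 D2 : Submodule F (Fin m → F)} (hm : 2 ≤ m) (h1 : Module.finrank F D1 = m - 1)
    (h2 : Module.finrank F D2 = m - 1) (hne : D1 ≠ D2) :
    D1 ⊔ D2 = ⊤ ∧ Module.finrank F (D1 ⊓ D2 : Submodule F (Fin m → F)) = m - 2 := by
  have hm' : Module.finrank F (Fin m → F) = m := by simp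
  have h3 := Submodule.finrank_sup_add_finrank_inf_eq D1 D2
  have h4 : Module.finrank F (D1 ⊔ D2 : Submodule F (Fin m → F)) ≤ m := by
    have := Submodule.finrank_le (D1 ⊔ D2); rwa [hm'] at this
  have h5 : m - 1 < Module.finrank F (D1 ⊔ D2 : Submodule F (Fin m → F)) := by
    by_contra hlt
    apply hne
    have a1 := Submodule.eq_of_le_of_finrank_le (le_sup_left : D1 ≤ D1 ⊔ D2) (by omega)
    have a2 := Submodule.eq_of_le_of_finrank_le (le_sup_right : D2 ≤ D1 ⊔ D2) (by omega)
    exact a1.trans a2.symm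
  refine ⟨Submodule.eq_top_of_finrank_eq (by omega), by omega⟩

theorem revA (hm : 2 ≤ m) (L : Finset (AffineSubspace F (Fin m → F)))
    (hL : ∀ H ∈ L, (H : Set (Fin m → F)).Nonempty ∧ Module.finrank F H.direction = m - 1)
    (hp : ∀ H1 ∈ L, ∀ H2 ∈ L, AffineSubspace.direction H1 = AffineSubspace.direction H2)
    (H' : AffineSubspace F (Fin m → F)) (h' : (H' : Set (Fin m → F)).Nonempty)
    (hr : Module.finrank F H'.direction = m - 1)
    (hne : ∀ H ∈ L, AffineSubspace.direction H ≠ AffineSubspace.direction H') :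
    ((⋃ H ∈ L, (H : Set (Fin m → F))) \ (H' : Set (Fin m → F))).ncard =
      L.card * (Fintype.card F ^ (m - 1) - Fintype.card F ^ (m - 2)) := by
  have e : (⋃ H ∈ L, (H : Set (Fin m → F))) \ (H' : Set (Fin m → F)) =
      ⋃ H ∈ L, ((H : Set (Fin m → F)) \ (H' : Set (Fin m → F))) := by
    ext x; simp only [Set.mem_sdiff, Set.mem_iUnion]; tauto
  rw [e]
  apply ncard_iUnion_eq
  · intro H hH
    obtain ⟨s1, s2⟩ := hyper_sup hm (hL H hH).2 hr (hne H hH)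
    have hi := AffineSubspace.inter_nonempty_of_nonempty_of_sup_direction_eq_top (hL H hH).1 h' s1
    obtain ⟨p, hp1, hp2⟩ := hi
    have hd := AffineSubspace.direction_inf_of_mem (s₁ := H) (s₂ := H') hp1 hp2
    have c1 := ncard_aff H (hL H hH).1 (hL H hH).2
    have c2 := ncard_aff (k := m - 2) (H ⊓ H') ⟨p, hp1, hp2⟩ (by rw [hd, s2])
    have c3 := Set.ncard_sdiff_add_ncard_of_subset
      (s := ((H ⊓ H' : AffineSubspace F (Fin m → F)) : Set (Fin m → F))) (t := (H : Set (Fin m → F)))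
      (fun x hx => hx.1)
    have c4 : (H : Set (Fin m → F)) \ ((H ⊓ H' : AffineSubspace F (Fin m → F)) : Set (Fin m → F)) =
        (H : Set (Fin m → F)) \ H' := by
      ext x
      have : x ∈ ((H ⊓ H' : AffineSubspace F (Fin m → F)) : Set (Fin m → F)) ↔
        x ∈ (H : Set (Fin m → F)) ∧ x ∈ (H' : Set (Fin m → F)) := Iff.rfl
      simp only [Set.mem_sdiff, this]; tauto
    rw [c4] at c3
    omega
  · intro H1 h1 H2 h2 hn
    rw [Set.disjoint_left]
    intro x hx1 hx2
    exact hn (AffineSubspace.ext_of_direction_eq (hp H1 h1 H2 h2) ⟨x, hx1.1, hx2.1⟩)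

theorem revB (hm : 2 ≤ m) (L : Finset (AffineSubspace F (Fin m → F)))
    (hL : ∀ H ∈ L, (H : Set (Fin m → F)).Nonempty ∧ Module.finrank F H.direction = m - 1)
    (A : AffineSubspace F (Fin m → F)) (h' : (A : Set (Fin m → F)).Nonempty)
    (hr : Module.finrank F A.direction = m - 2)
    (hle : ∀ H ∈ L, A ≤ H) :
    ((⋃ H ∈ L, (H : Set (Fin m → F))) \ (A : Set (Fin m → F))).ncard =
      L.card * (Fintype.card F ^ (m - 1) - Fintype.card F ^ (m - 2)) := by
  have e : (⋃ H ∈ L, (H : Set (Fin m → F))) \ (A : Set (Fin m → F)) =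
      ⋃ H ∈ L, ((H : Set (Fin m → F)) \ (A : Set (Fin m → F))) := by
    ext x; simp only [Set.mem_sdiff, Set.mem_iUnion]; tauto
  rw [e]
  apply ncard_iUnion_eq
  · intro H hH
    have c1 := ncard_aff H (hL H hH).1 (hL H hH).2
    have c2 := ncard_aff A h' hr
    have c3 := Set.ncard_sdiff_add_ncard_of_subset (s := (A : Set (Fin m → F)))
      (t := (H : Set (Fin m → F))) (fun x hx => hle H hH hx)
    omega
  · intro H1 h1 H2 h2 hn
    rw [Set.disjoint_left]
    intro x hx1 hx2
    obtain ⟨p, hp⟩ := h'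
    have hdn : H1.direction ≠ H2.direction := fun hd =>
      hn (AffineSubspace.ext_of_direction_eq hd ⟨x, hx1.1, hx2.1⟩)
    obtain ⟨-, s2⟩ := hyper_sup hm (hL H1 h1).2 (hL H2 h2).2 hdn
    have hd := AffineSubspace.direction_inf_of_mem (s₁ := H1) (s₂ := H2) hx1.1 hx2.1
    have hle' : A ≤ H1 ⊓ H2 := le_inf (hle H1 h1) (hle H2 h2)
    have hdd := Submodule.eq_of_le_of_finrank_eq (AffineSubspace.direction_le hle')
      (by rw [hr, hd, s2])
    have := AffineSubspace.ext_of_direction_eq hdd ⟨p, hp, hle' hp⟩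
    exact hx1.2 (this ▸ (⟨hx1.1, hx2.1⟩ : x ∈ H1 ⊓ H2))

theorem mk_hyp (y : (Fin m → F) →ₗ[F] F) (hy : y ≠ 0) (a : F) :
    ∃ H : AffineSubspace F (Fin m → F), (∀ x, x ∈ H ↔ y x = a) ∧ H.direction = LinearMap.ker y ∧
      (H : Set (Fin m → F)).Nonempty ∧ Module.finrank F H.direction = m - 1 := by
  obtain ⟨p, hp⟩ := exists_val y hy a
  refine ⟨AffineSubspace.mk' p (LinearMap.ker y), fun x => ?_, AffineSubspace.direction_mk' _ _,
    AffineSubspace.mk'_nonempty _ _, ?_⟩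
  · rw [AffineSubspace.mem_mk', vsub_eq_sub, LinearMap.mem_ker, map_sub, hp, sub_eq_zero]
  · rw [AffineSubspace.direction_mk']
    have h1 := LinearMap.finrank_range_add_finrank_ker y
    have h2 : LinearMap.range y = ⊤ := by
      rw [LinearMap.range_eq_top]
      intro t
      exact exists_val y hy t
    rw [h2] at h1
    simp at h1
    omega

theorem fwdA {c : ℕ} {f : (Fin m → F) → F} (h : TypeA c f) :
    ∃ L : Finset (AffineSubspace F (Fin m → F)),
        L.card = c + 1 ∧
        (∀ H ∈ L, (H : Set (Fin m → F)).Nonempty ∧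
          Module.finrank F H.direction = m - 1) ∧
        (∀ H1 ∈ L, ∀ H2 ∈ L, AffineSubspace.direction H1 = AffineSubspace.direction H2) ∧
        ∃ H' : AffineSubspace F (Fin m → F),
          (H' : Set (Fin m → F)).Nonempty ∧ Module.finrank F H'.direction = m - 1 ∧
          (∀ H ∈ L, AffineSubspace.direction H ≠ AffineSubspace.direction H') ∧
          {x : Fin m → F | f x ≠ 0} =
            (⋃ H ∈ L, (H : Set (Fin m → F))) \ (H' : Set (Fin m → F)) := by
  obtain ⟨y, z, e, K, hy, ⟨v, hv0, hv1⟩, hK, hz⟩ := h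
  have hz0 : z ≠ 0 := by rintro rfl; simp at hv1
  choose HH h1 h2 h3 h4 using mk_hyp y hy
  obtain ⟨H', g1, g2, g3, g4⟩ := mk_hyp z hz0 e
  have hinj : Function.Injective HH := by
    intro a b hab
    obtain ⟨p, hp⟩ := h3 a
    rw [← (h1 a p).1 hp, (h1 b p).1 (hab ▸ hp)]
  refine ⟨K.image HH, by rw [Finset.card_image_of_injective _ hinj, hK], ?_, ?_, H', g3, g4, ?_, ?_⟩
  · intro H hH
    obtain ⟨a, -, rfl⟩ := Finset.mem_image.1 hH
    exact ⟨h3 a, h4 a⟩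
  · intro H1 hH1 H2 hH2
    obtain ⟨a, -, rfl⟩ := Finset.mem_image.1 hH1
    obtain ⟨a', -, rfl⟩ := Finset.mem_image.1 hH2
    rw [h2, h2]
  · intro H hH
    obtain ⟨a, -, rfl⟩ := Finset.mem_image.1 hH
    rw [h2, g2]
    intro hk
    have : v ∈ LinearMap.ker z := hk ▸ (LinearMap.mem_ker.2 hv0)
    rw [LinearMap.mem_ker, hv1] at this
    exact one_ne_zero this
  · ext x
    simp only [Set.mem_setOf_eq, Set.mem_sdiff, Set.mem_iUnion, SetLike.mem_coe, g1, hz x]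
    constructor
    · rintro ⟨hx, hx'⟩
      exact ⟨⟨HH (y x), Finset.mem_image_of_mem _ hx, (h1 _ _).2 rfl⟩, hx'⟩
    · rintro ⟨⟨H, hH, hx⟩, hx'⟩
      obtain ⟨a, ha, rfl⟩ := Finset.mem_image.1 hH
      rw [(h1 a x).1 hx]
      exact ⟨ha, hx'⟩

theorem fwdB (hm : 2 ≤ m) {c : ℕ} {f : (Fin m → F) → F} (h : TypeB c f) :
    ∃ L : Finset (AffineSubspace F (Fin m → F)),
        L.card = c + 1 ∧
        (∀ H ∈ L, (H : Set (Fin m → F)).Nonempty ∧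
          Module.finrank F H.direction = m - 1) ∧
        ∃ A : AffineSubspace F (Fin m → F),
          (A : Set (Fin m → F)).Nonempty ∧ Module.finrank F A.direction = m - 2 ∧
          (∀ H ∈ L, A ≤ H) ∧
          {x : Fin m → F | f x ≠ 0} =
            (⋃ H ∈ L, (H : Set (Fin m → F))) \ (A : Set (Fin m → F)) := by
  obtain ⟨y, z, a, e, K, hy, hv, hK, hz⟩ := h
  have hz0 : z ≠ 0 := by
    rintro rfl
    obtain ⟨v, hv0, hv1⟩ := hv
    simp at hv1
  choose HH h1 h2 h3 h4 using fun σ : F => mk_hyp (z - σ • y) (pencil_ne y z hv σ) (e - σ * a)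
  have h1' : ∀ σ x, x ∈ HH σ ↔ z x - e = σ * (y x - a) := by
    intro σ x
    rw [h1]
    simp only [LinearMap.sub_apply, LinearMap.smul_apply, smul_eq_mul]
    constructor <;> intro h <;> linear_combination h
  obtain ⟨B, b1, b2, b3, b4⟩ := mk_hyp y hy a
  obtain ⟨C, c1, c2, c3, c4⟩ := mk_hyp z hz0 e
  have hBC : B.direction ≠ C.direction := by
    rw [b2, c2]
    intro hk
    obtain ⟨v, hv0, hv1⟩ := hv
    have : v ∈ LinearMap.ker z := hk ▸ (LinearMap.mem_ker.2 hv0)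
    rw [LinearMap.mem_ker, hv1] at this
    exact one_ne_zero this
  obtain ⟨p, hp1, hp2⟩ := exists_pt y z hy hv a e
  have hpB := (b1 p).2 hp1
  have hpC := (c1 p).2 hp2
  have hA : ∀ x, x ∈ B ⊓ C ↔ y x = a ∧ z x = e := by
    intro x
    rw [AffineSubspace.mem_inf_iff, b1, c1]
  have hinj : Function.Injective HH := by
    intro σ τ hab
    obtain ⟨w, hw1, hw2⟩ := exists_pt y z hy hv (a + 1) (e + σ)
    have hw : w ∈ HH σ := by rw [h1', hw1, hw2]; ring
    rw [hab, h1', hw1, hw2] at hw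
    linear_combination hw
  refine ⟨K.image HH, by rw [Finset.card_image_of_injective _ hinj, hK], ?_, B ⊓ C,
    ⟨p, hpB, hpC⟩, ?_, ?_, ?_⟩
  · intro H hH
    obtain ⟨a, -, rfl⟩ := Finset.mem_image.1 hH
    exact ⟨h3 a, h4 a⟩
  · rw [AffineSubspace.direction_inf_of_mem hpB hpC]
    exact (hyper_sup hm b4 c4 hBC).2
  · intro H hH x hx
    obtain ⟨σ, -, rfl⟩ := Finset.mem_image.1 hH
    obtain ⟨hx1, hx2⟩ := (hA x).1 hx
    rw [h1', hx1, hx2]; ring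
  · ext x
    simp only [Set.mem_setOf_eq, Set.mem_sdiff, Set.mem_iUnion, SetLike.mem_coe, hA, hz x]
    constructor
    · rintro ⟨hx, σ, hσ, hx'⟩
      exact ⟨⟨HH σ, Finset.mem_image_of_mem _ hσ, (h1' _ _).2 hx'⟩, fun h => hx h.1⟩
    · rintro ⟨⟨H, hH, hx⟩, hx'⟩
      obtain ⟨σ, hσ, rfl⟩ := Finset.mem_image.1 hH
      rw [h1'] at hx
      refine ⟨fun hya => hx' ⟨hya, ?_⟩, σ, hσ, hx⟩
      rw [hya] at hx
      linear_combination hx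

end A13



/-- Membership in the generalized Reed–Muller code `R_q(r,m)`: `f` is represented by a
polynomial of total degree at most `r` (equivalently, its reduced form has degree ≤ r). -/
def RM (F : Type) [Field F] (r m : ℕ) (f : (Fin m → F) → F) : Prop :=
  ∃ P : MvPolynomial (Fin m) F, P.totalDegree ≤ r ∧ ∀ x, MvPolynomial.eval x P = f x

/-- Hamming weight: the size of the support of `f`. -/
def wt {F : Type} [Field F] [Fintype F] [DecidableEq F] {m : ℕ} (f : (Fin m → F) → F) : ℕ :=
  (Finset.univ.filter fun x => f x ≠ 0).card

/-- The second weight codewords of `R_q(b,m)`, `2 ≤ b ≤ q-1`, are exactly those whose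
support is (A) the union of `q-b+1` parallel affine hyperplanes minus their intersection
with a non-parallel hyperplane, or (B) the union of `q-b+1` hyperplanes containing a common
affine subspace of codimension 2, minus that subspace. -/
theorem stmt10 {F : Type} [Field F] [Fintype F] [DecidableEq F] {m b : ℕ}
    (hq : 3 ≤ Fintype.card F) (hm : 2 ≤ m) (hb1 : 2 ≤ b) (hb2 : b ≤ Fintype.card F - 1)
    (f : (Fin m → F) → F) (hf : RM F b m f) :
    wt f = (Fintype.card F - b + 1) * (Fintype.card F - 1) * Fintype.card F ^ (m - 2) ↔
    ((∃ L : Finset (AffineSubspace F (Fin m → F)),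
        L.card = Fintype.card F - b + 1 ∧
        (∀ H ∈ L, (H : Set (Fin m → F)).Nonempty ∧
          Module.finrank F H.direction = m - 1) ∧
        (∀ H1 ∈ L, ∀ H2 ∈ L, AffineSubspace.direction H1 = AffineSubspace.direction H2) ∧
        ∃ H' : AffineSubspace F (Fin m → F),
          (H' : Set (Fin m → F)).Nonempty ∧ Module.finrank F H'.direction = m - 1 ∧
          (∀ H ∈ L, AffineSubspace.direction H ≠ AffineSubspace.direction H') ∧
          {x : Fin m → F | f x ≠ 0} =
            (⋃ H ∈ L, (H : Set (Fin m → F))) \ (H' : Set (Fin m → F))) ∨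
     (∃ L : Finset (AffineSubspace F (Fin m → F)),
        L.card = Fintype.card F - b + 1 ∧
        (∀ H ∈ L, (H : Set (Fin m → F)).Nonempty ∧
          Module.finrank F H.direction = m - 1) ∧
        ∃ A : AffineSubspace F (Fin m → F),
          (A : Set (Fin m → F)).Nonempty ∧ Module.finrank F A.direction = m - 2 ∧
          (∀ H ∈ L, A ≤ H) ∧
          {x : Fin m → F | f x ≠ 0} =
            (⋃ H ∈ L, (H : Set (Fin m → F))) \ (A : Set (Fin m → F)))) := by
  obtain ⟨c, hbc⟩ : ∃ c, b + c = Fintype.card F := ⟨Fintype.card F - b, by omega⟩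
  have hc : Fintype.card F - b = c := by omega
  rw [hc]
  have hwt : wt f = cnt (fun x => f x ≠ 0) := by
    rw [cnt_eq]; rfl
  have hwt' : wt f = {x | f x ≠ 0}.ncard := hwt
  have hW : (c + 1) * (Fintype.card F ^ (m - 1) - Fintype.card F ^ (m - 2)) =
      (c + 1) * (Fintype.card F - 1) * Fintype.card F ^ (m - 2) := by
    obtain ⟨k, rfl⟩ : ∃ k, m = k + 2 := ⟨m - 2, by omega⟩
    have e1 : k + 2 - 1 = k + 1 := by omega
    have e2 : k + 2 - 2 = k := by omega
    rw [e1, e2, mul_assoc, Nat.sub_mul, one_mul, pow_succ']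
  constructor
  · intro h
    obtain ⟨P, hP, hPf⟩ := hf
    have hPD : PD F b f := by
      have h1 := (PD.of_mv P).mono hP
      exact h1.congr (fun x => (hPf x).symm)
    have h2 := forward hPD hbc (by omega) hb1 (by
      rw [← hwt, h, Nat.card_fun, Nat.card_eq_fintype_card, Nat.card_eq_fintype_card,
        Fintype.card_fin]
      obtain ⟨k, rfl⟩ : ∃ k, m = k + 2 := ⟨m - 2, by omega⟩
      have e2 : k + 2 - 2 = k := by omega
      rw [e2]
      ring)
    rcases h2 with h2 | h2
    · exact Or.inl (fwdA h2)
    · exact Or.inr (fwdB hm h2)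
  · rintro (⟨L, hLc, hL, hp, H', h', hr, hne, hS⟩ | ⟨L, hLc, hL, A, h', hr, hle, hS⟩)
    · rw [hwt', hS, revA hm L hL hp H' h' hr hne, hLc, hW]
    · rw [hwt', hS, revB hm L hL A h' hr hle, hLc, hW]
end

section
/- Let $m\geq3$, $q\geq4$, $1\leq t\leq m-2$, $2\leq s\leq q-2$. If $f\in R_q(t(q-1)+s,m)$ satisfies $|f|=(q-s+1)(q-1)q^{m-t-2}$, then the support of $f$ is contained in an affine hyperplane of $\mathbb{F}_q^m$. -/
section helpers
open Finset

lemma lemA {ι : Type} [DecidableEq ι] (p : ℕ) (b : ι → ℕ) (I : Finset ι) :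
    (∀ i ∈ I, b i ≤ p) → ∀ k v : ℕ, v ≤ p → k * p + v ≤ ∑ i ∈ I, b i →
    (v + 1) * (p + 1) ^ k ≤ ∏ i ∈ I, (b i + 1) := by
  induction I using Finset.induction_on with
  | empty =>
    intro _ k v hv h
    simp only [sum_empty, prod_empty] at *
    have hv0 : v = 0 := by omega
    subst hv0
    rcases Nat.eq_zero_or_pos k with hk | hk
    · simp [hk]
    · have : p = 0 := by
        have : k * p = 0 := by omega
        rcases Nat.mul_eq_zero.mp this with h | h <;> omega
      simp [this]
  | insert a I ha ih =>
    intro hb k v hv h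
    rw [sum_insert ha] at h
    rw [prod_insert ha]
    have hI : ∀ i ∈ I, b i ≤ p := fun i hi => hb i (mem_insert_of_mem hi)
    have hc : b a ≤ p := hb a (mem_insert_self _ _)
    generalize b a = c at *
    rcases le_or_gt c v with hcv | hcv
    · obtain ⟨d, rfl⟩ := Nat.exists_eq_add_of_le hcv
      have := ih hI k d (by omega) (by omega)
      calc (c + d + 1) * (p + 1) ^ k ≤ ((c + 1) * (d + 1)) * (p + 1) ^ k := by
            apply Nat.mul_le_mul_right; nlinarith [Nat.zero_le (c * d)]
        _ = (c + 1) * ((d + 1) * (p + 1) ^ k) := by ring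
        _ ≤ _ := Nat.mul_le_mul_left _ this
    · rcases k with _ | k
      · obtain ⟨d, rfl⟩ := Nat.exists_eq_add_of_lt hcv
        have : 1 ≤ ∏ i ∈ I, (b i + 1) := Finset.prod_pos (fun i _ => Nat.succ_pos _)
        simp only [pow_zero, mul_one]
        nlinarith
      · obtain ⟨d, rfl⟩ := Nat.exists_eq_add_of_lt hcv
        obtain ⟨g, rfl⟩ := Nat.exists_eq_add_of_le hc
        have := ih hI k (v + g) (by omega) (by
          have : (k + 1) * (v + d + 1 + g) = k * (v + d + 1 + g) + (v + d + 1 + g) := by ring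
          omega)
        set X := (v + d + 1 + g + 1) ^ k with hX
        calc (v + 1) * (v + d + 1 + g + 1) ^ (k + 1) = ((v + 1) * (v + d + 1 + g + 1)) * X := by
              rw [pow_succ, ← hX]; ring
          _ ≤ ((v + d + 1 + 1) * (v + g + 1)) * X := by
              apply Nat.mul_le_mul_right; nlinarith [Nat.zero_le (d * g)]
          _ = (v + d + 1 + 1) * ((v + g + 1) * X) := by ring
          _ ≤ _ := Nat.mul_le_mul_left _ this

lemma cd1 (c d : ℕ) (hc : 1 ≤ c) (hd : 1 ≤ d) : 2 * (c + d) ≤ (c + 1) * (d + 1) := by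
  obtain ⟨c, rfl⟩ := Nat.exists_eq_add_of_le hc
  obtain ⟨d, rfl⟩ := Nat.exists_eq_add_of_le hd
  nlinarith [Nat.zero_le (c * d)]

lemma cd2 (p c d g : ℕ) (hc : c < p) (hd : d < p) (hg : c + d = p + g) :
    p * (g + 2) ≤ (c + 1) * (d + 1) := by
  zify at *
  have hg' : (g : ℤ) = c + d - p := by omega
  rw [hg']
  nlinarith [mul_nonneg (show (0:ℤ) ≤ p - 1 - c by omega) (show (0:ℤ) ≤ p - 1 - d by omega)]

/-- two interior coordinates -/
lemma lemB (p l v c d r R : ℕ) (hv : 1 ≤ v) (hvp : v + 2 ≤ p) (hc : 1 ≤ c) (hd : 1 ≤ d)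
    (hcp : c < p) (hdp : d < p) (hs : c + d + r = (l + 1) * p + v)
    (hR : ∀ k v, v ≤ p → k * p + v ≤ r → (v + 1) * (p + 1) ^ k ≤ R) :
    (v + 2) * p * (p + 1) ^ l ≤ (c + 1) * (d + 1) * R ∧
    (c + d ≠ p + v → (v + 2) * p * (p + 1) ^ l < (c + 1) * (d + 1) * R) := by
  have h1 := cd1 c d hc hd
  have h2 := cd2 p c d
  have key : ∀ Y Z W X : ℕ, Y ≤ (c + 1) * (d + 1) → Z * X ≤ R → W < Y * Z → 0 < X →
      W * X < (c + 1) * (d + 1) * R := by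
    intro Y Z W X h1 h2 h3 h4
    calc W * X < Y * Z * X := Nat.mul_lt_mul_of_pos_right h3 h4
      _ = Y * (Z * X) := by ring
      _ ≤ _ := Nat.mul_le_mul h1 h2
  have key' : ∀ Y Z W X : ℕ, Y ≤ (c + 1) * (d + 1) → Z * X ≤ R → W ≤ Y * Z →
      W * X ≤ (c + 1) * (d + 1) * R := by
    intro Y Z W X h1 h2 h3
    calc W * X ≤ Y * Z * X := Nat.mul_le_mul_right _ h3
      _ = Y * (Z * X) := by ring
      _ ≤ _ := Nat.mul_le_mul h1 h2
  have hX : 0 < (p + 1) ^ l := by positivity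
  have hexp : (l + 1) * p = l * p + p := by ring
  suffices h : (v + 2) * p * (p + 1) ^ l < (c + 1) * (d + 1) * R ∨
      (c + d = p + v ∧ (v + 2) * p * (p + 1) ^ l ≤ (c + 1) * (d + 1) * R) by
    rcases h with h | ⟨h, h'⟩
    · exact ⟨h.le, fun _ => h⟩
    · exact ⟨h', fun h'' => absurd h h''⟩
  generalize he : c + d = e at *
  rcases le_or_gt e v with hev | hev
  · left
    obtain ⟨f, rfl⟩ := Nat.exists_eq_add_of_le hev
    have hr := hR (l + 1) f (by omega) (by omega)
    refine key _ ((f + 1) * (p + 1)) _ _ h1 (by rw [pow_succ] at hr; linarith) ?_ hX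
    have h3 : e + f + 2 ≤ 2 * e * (f + 1) := by nlinarith
    nlinarith [Nat.mul_le_mul_right p h3, Nat.zero_le (e * f)]
  rcases le_or_gt e (p + v) with hev2 | hev2
  · obtain ⟨f, hf⟩ := Nat.exists_eq_add_of_le hev2
    have hr := hR l f (by omega) (by omega)
    rcases le_or_gt e p with hep | hep
    · left
      refine key _ (f + 1) _ _ h1 hr ?_ hX
      obtain ⟨x, rfl⟩ := Nat.exists_eq_add_of_le hep
      obtain ⟨y, rfl⟩ := Nat.exists_eq_add_of_lt hev
      have : f = x + v := by omega
      subst this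
      nlinarith [Nat.zero_le (x * y), Nat.zero_le (v * y), Nat.zero_le (v * x), Nat.zero_le (v*v)]
    · obtain ⟨g, rfl⟩ := Nat.exists_eq_add_of_le hep.le
      have hg : v = g + f := by omega
      have h3 := h2 g hcp hdp rfl
      rcases Nat.eq_zero_or_pos f with hf0 | hf0
      · right
        refine ⟨by omega, key' _ (f + 1) _ _ h3 hr ?_⟩
        subst hf0; subst hg; nlinarith
      · left
        refine key _ (f + 1) _ _ h3 hr ?_ hX
        subst hg
        have : g + f + 2 < (g + 2) * (f + 1) := by nlinarith
        nlinarith [Nat.mul_lt_mul_of_pos_right this (show 0 < p by omega)]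
  · left
    obtain ⟨g, rfl⟩ := Nat.exists_eq_add_of_le (show p ≤ e by omega)
    have h3 := h2 g hcp hdp rfl
    rcases l with _ | l
    · omega
    obtain ⟨x, hx⟩ := Nat.exists_eq_add_of_lt (show v < g by omega)
    obtain ⟨y, hy⟩ := Nat.exists_eq_add_of_le (show g + 2 ≤ p by omega)
    have hexp2 : (l + 1) * p = l * p + p := by ring
    have hr := hR l (v + 2 + y) (by omega) (by omega)
    have := key (p * (g + 2)) (v + 2 + y + 1) ((v + 2) * p * (p + 1)) ((p + 1) ^ l) h3 hr ?_
      (by positivity)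
    · rw [pow_succ]; linarith
    · have : (v + 2) * (p + 1) < (g + 2) * (v + 2 + y + 1) := by
        subst hx; subst hy; nlinarith [Nat.zero_le (x * y)]
      nlinarith [Nat.mul_lt_mul_of_pos_right this (show 0 < p by omega)]

lemma exists_lt_of_sum {ι : Type} (p : ℕ) (b : ι → ℕ) (I : Finset ι)
    (h : ∑ i ∈ I, b i < I.card * p) : ∃ i ∈ I, b i < p := by
  by_contra hcon
  push Not at hcon
  have := Finset.card_nsmul_le_sum I b p hcon
  rw [smul_eq_mul] at this
  exact absurd h (not_lt.2 this)

lemma lemC {m : ℕ} (p l v : ℕ) (b : Fin m → ℕ) (hv : 1 ≤ v) (hvp : v + 2 ≤ p)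
    (hm : l + 3 ≤ m) (hb : ∀ i, b i ≤ p) (hb1 : ∀ i, 1 ≤ b i)
    (hs : ∑ i, b i = (l + 1) * p + v) :
    (v + 2) * p * (p + 1) ^ l < ∏ i, (b i + 1) := by
  have hm' : (l + 3) * p ≤ m * p := Nat.mul_le_mul_right _ hm
  obtain ⟨i, hi, hip⟩ := exists_lt_of_sum p b univ (by
    rw [hs, card_univ, Fintype.card_fin]; nlinarith)
  obtain ⟨n, rfl⟩ : ∃ n, m = n + 3 := ⟨m - 3, by omega⟩
  have c1 : (univ.erase i).card = n + 2 := by rw [card_erase_of_mem hi]; simp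
  have s1 := Finset.add_sum_erase univ b hi
  have p1 := Finset.mul_prod_erase univ (fun i => b i + 1) hi
  obtain ⟨j, hj, hjp⟩ := exists_lt_of_sum p b (univ.erase i) (by rw [c1]; nlinarith)
  have c2 : ((univ.erase i).erase j).card = n + 1 := by rw [card_erase_of_mem hj, c1]; simp
  have s2 := Finset.add_sum_erase _ b hj
  have p2 := Finset.mul_prod_erase _ (fun i => b i + 1) hj
  have hB := lemB p l v (b i) (b j) (∑ k ∈ (univ.erase i).erase j, b k)
    (∏ k ∈ (univ.erase i).erase j, (b k + 1)) hv hvp (hb1 i) (hb1 j) hip hjp (by omega)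
    (lemA p b _ (fun i _ => hb i))
  have pp : ∏ i, (b i + 1) = (b i + 1) * (b j + 1) *
      ∏ k ∈ (univ.erase i).erase j, (b k + 1) := by
    rw [← p1, ← p2]; ring
  rw [pp]
  by_cases he : b i + b j = p + v
  swap
  · exact hB.2 he
  have hexp : (l + 1) * p = l * p + p := by ring
  obtain ⟨z, hz, hzp⟩ := exists_lt_of_sum p b ((univ.erase i).erase j) (by
    rw [c2]
    have : l * p ≤ n * p := Nat.mul_le_mul_right _ (by omega)
    nlinarith)
  have s3 := Finset.add_sum_erase _ b hz
  have p3 := Finset.mul_prod_erase _ (fun i => b i + 1) hz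
  have hz1 := hb1 z
  rcases l with _ | l
  · omega
  have hexp2 : (l + 1) * p = l * p + p := by ring
  have hA := lemA p b (((univ.erase i).erase j).erase z) (fun i _ => hb i) l (p - b z) (by omega)
    (by omega)
  have h2 := cd2 p (b i) (b j) v hip hjp he
  rw [← p3]
  calc (v + 2) * p * (p + 1) ^ (l + 1) = (p * (v + 2)) * ((p + 1) * (p + 1) ^ l) := by ring
    _ < (p * (v + 2)) * ((b z + 1) * ((p - b z + 1) * (p + 1) ^ l)) := by
      apply Nat.mul_lt_mul_of_pos_left _ (by nlinarith)
      rw [← mul_assoc]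
      apply Nat.mul_lt_mul_of_pos_right _ (by positivity)
      obtain ⟨y, hy⟩ := Nat.exists_eq_add_of_lt hzp
      have : p - b z = y + 1 := by omega
      rw [this]; nlinarith
    _ ≤ _ := Nat.mul_le_mul h2 (Nat.mul_le_mul_left _ hA)

lemma exists_le_sum {m : ℕ} (D : ℕ) (n : ℕ) : ∀ b : Fin m → ℕ, ∑ i, b i = D + n →
    ∃ a ≤ b, ∑ i, a i = D := by
  induction n with
  | zero => intro b h; exact ⟨b, le_refl _, h⟩
  | succ n ih =>
    intro b h
    obtain ⟨i, hi, hi0⟩ : ∃ i ∈ univ, b i ≠ 0 := by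
      apply Finset.exists_ne_zero_of_sum_ne_zero; omega
    have hle : Function.update b i (b i - 1) ≤ b := by
      intro j; by_cases hj : j = i
      · subst hj; simp
      · simp [hj]
    obtain ⟨a, ha, hs⟩ := ih (Function.update b i (b i - 1)) (by
      rw [Finset.sum_update_of_mem hi]
      have := Finset.add_sum_erase univ b hi
      rw [Finset.sdiff_singleton_eq_erase]; omega)
    exact ⟨a, ha.trans hle, hs⟩

lemma le_sum_pred {m : ℕ} (a b : Fin m → ℕ) (h : a ≤ b) (hs : ∑ i, b i ≤ ∑ i, a i + 1) :
    a = b ∨ ∃ i, b i ≠ 0 ∧ a = Function.update b i (b i - 1) := by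
  by_cases hab : a = b
  · exact Or.inl hab
  right
  obtain ⟨i, hi⟩ : ∃ i, a i ≠ b i := by
    by_contra hc; push Not at hc; exact hab (funext hc)
  have hlt : a i < b i := lt_of_le_of_ne (h i) hi
  have s1 := Finset.add_sum_erase univ b (mem_univ i)
  have s2 := Finset.add_sum_erase univ a (mem_univ i)
  have s3 : ∑ j ∈ univ.erase i, a j ≤ ∑ j ∈ univ.erase i, b j := sum_le_sum fun j _ => h j
  have s4 : ∑ j ∈ univ.erase i, a j = ∑ j ∈ univ.erase i, b j := by omega
  have s5 := (Finset.sum_eq_sum_iff_of_le (fun j _ => h j)).1 s4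
  refine ⟨i, by omega, funext fun j => ?_⟩
  by_cases hj : j = i
  · subst hj; simp; omega
  · simp only [Function.update_of_ne hj]; exact s5 j (by simp [hj])

theorem comb {m : ℕ} (p l v : ℕ) (Δ : Finset (Fin m → ℕ)) (hv : 1 ≤ v) (hvp : v + 2 ≤ p)
    (hm : l + 3 ≤ m) (hdown : ∀ a ∈ Δ, ∀ b ≤ a, b ∈ Δ) (hbox : ∀ a ∈ Δ, ∀ i, a i ≤ p)
    (hcard : Δ.card = (v + 2) * p * (p + 1) ^ l)
    (h1 : ∃ b ∈ Δ, (l + 1) * p + v ≤ ∑ i, b i)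
    (h2 : m + 1 ≤ (Δ.filter fun a => (l + 1) * p + v ≤ ∑ i, a i + 1).card) : False := by
  obtain ⟨b₀, hb₀, hs₀⟩ := h1
  obtain ⟨n, hn⟩ := Nat.exists_eq_add_of_le hs₀
  obtain ⟨b, hbb, hs⟩ := exists_le_sum _ n b₀ hn
  have hb : b ∈ Δ := hdown _ hb₀ _ hbb
  have hbp := hbox b hb
  let bx := Fintype.piFinset (fun i => range (b i + 1))
  have hbx : ∀ a, a ∈ bx ↔ a ≤ b := by
    intro a; simp only [bx, Fintype.mem_piFinset, mem_range, Nat.lt_succ_iff]; rfl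
  have hbxc : bx.card = ∏ i, (b i + 1) := by simp [bx, Fintype.card_piFinset]
  have hbxΔ : bx ⊆ Δ := fun a ha => hdown b hb a ((hbx a).1 ha)
  have hle := card_le_card hbxΔ
  by_cases hz : ∀ i, 1 ≤ b i
  · have := lemC p l v b hv hvp hm hbp hz hs
    omega
  push Not at hz
  obtain ⟨z, hz⟩ := hz
  have hz0 : b z = 0 := by omega
  obtain ⟨b', hb', hs', hnle⟩ : ∃ b' ∈ Δ, (l + 1) * p + v ≤ ∑ i, b' i + 1 ∧ ¬ b' ≤ b := by
    by_contra hcon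
    push Not at hcon
    have hsub : (Δ.filter fun a => (l + 1) * p + v ≤ ∑ i, a i + 1) ⊆
        insert b ((univ.erase z).image fun i => Function.update b i (b i - 1)) := by
      intro a ha
      rw [mem_filter] at ha
      rcases le_sum_pred a b (hcon a ha.1 ha.2) (by omega) with h | ⟨i, hi, h⟩
      · simp [h]
      · rw [mem_insert, mem_image]
        right
        refine ⟨i, ?_, h.symm⟩
        rw [mem_erase]
        exact ⟨fun h => hi (h ▸ hz0), mem_univ _⟩
    have c1 := card_le_card hsub
    have c2 := card_insert_le b ((univ.erase z).image fun i => Function.update b i (b i - 1))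
    have c3 := card_image_le (s := univ.erase z) (f := fun i => Function.update b i (b i - 1))
    rw [card_erase_of_mem (mem_univ _), card_univ, Fintype.card_fin] at c3
    omega
  by_cases hint : ∃ i j, i ≠ j ∧ 1 ≤ b i ∧ b i < p ∧ 1 ≤ b j ∧ b j < p
  · obtain ⟨i, j, hij, hi1, hip, hj1, hjp⟩ := hint
    have hj : j ∈ univ.erase i := by simp [hij.symm]
    have s1 := Finset.add_sum_erase univ b (mem_univ i)
    have p1 := Finset.mul_prod_erase univ (fun i => b i + 1) (mem_univ i)
    have s2 := Finset.add_sum_erase _ b hj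
    have p2 := Finset.mul_prod_erase _ (fun i => b i + 1) hj
    have hB := lemB p l v (b i) (b j) (∑ k ∈ (univ.erase i).erase j, b k)
      (∏ k ∈ (univ.erase i).erase j, (b k + 1)) hv hvp hi1 hj1 hip hjp (by omega)
      (lemA p b _ (fun i _ => hbp i))
    have pp : ∏ i, (b i + 1) = (b i + 1) * (b j + 1) *
        ∏ k ∈ (univ.erase i).erase j, (b k + 1) := by
      rw [← p1, ← p2]; ring
    have hss : insert b' bx ⊆ Δ := insert_subset hb' hbxΔ
    have := card_le_card hss
    rw [card_insert_of_notMem (fun h => hnle ((hbx _).1 h))] at this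
    have := hB.1
    omega
  · push Not at hint
    obtain ⟨i, hi⟩ : ∃ i, b i < b' i := by
      by_contra hc; push Not at hc; exact hnle hc
    have hb'p := hbox b' hb'
    have hip : b i < p := lt_of_lt_of_le hi (hb'p i)
    have hiv : b i ≤ v := by
      rcases Nat.eq_zero_or_pos (b i) with h0 | h0
      · omega
      · have hdvd : p ∣ ∑ j ∈ univ.erase i, b j := by
          apply Finset.dvd_sum
          intro j hj
          rw [mem_erase] at hj
          rcases Nat.eq_zero_or_pos (b j) with h0' | h0'
          · simp [h0']
          · have := hint i j hj.1.symm h0 hip h0'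
            have : b j = p := le_antisymm (hbp j) this
            simp [this]
        obtain ⟨N, hN⟩ := hdvd
        have s1 := Finset.add_sum_erase univ b (mem_univ i)
        rw [hN, hs] at s1
        have := congrArg (· % p) s1
        simp only [Nat.add_mul_mod_self_left, Nat.mul_add_mod_self_right] at this
        rw [Nat.mod_eq_of_lt hip, Nat.mod_eq_of_lt (by omega)] at this
        omega
    let c : Fin m → ℕ := Function.update b' i (b' i - b i - 1)
    let by' := Fintype.piFinset (fun j => if j = i then Finset.Ioc (b i) (b' i) else range (b' j + 1))
    have hyc : by'.card = ∏ j, (c j + 1) := by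
      simp only [by', Fintype.card_piFinset]
      apply prod_congr rfl
      intro j _
      by_cases hj : j = i
      · subst hj; simp [c]; omega
      · simp [c, hj]
    have hyΔ : by' ⊆ Δ := by
      intro a ha
      apply hdown b' hb'
      intro j
      have := (Fintype.mem_piFinset.1 ha) j
      by_cases hj : j = i
      · subst hj; simp at this; exact this.2
      · simp [hj] at this; omega
    have hdisj : Disjoint bx by' := by
      rw [Finset.disjoint_left]
      intro a ha ha'
      have h1 : a i ≤ b i := (hbx a).1 ha i
      have := (Fintype.mem_piFinset.1 ha') i
      simp at this
      omega
    have hcs : ∑ j, c j + b i + 1 = ∑ j, b' j := by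
      have s1 := Finset.add_sum_erase univ b' (mem_univ i)
      simp only [c]
      rw [Finset.sum_update_of_mem (mem_univ i), Finset.sdiff_singleton_eq_erase]
      omega
    have hexp : (l + 1) * p = l * p + p := by ring
    have hAc := lemA p c univ (by
      intro j _
      by_cases hj : j = i
      · subst hj; have := hb'p j; simp [c]; omega
      · simp [c, hj, hb'p]) l (p - 2) (by omega) (by omega)
    have hAb := lemA p b univ (fun j _ => hbp j) (l + 1) v (by omega) (by omega)
    have hU := card_le_card (union_subset hbxΔ hyΔ)
    rw [card_union_of_disjoint hdisj, hbxc, hyc, hcard] at hU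
    have hX : 0 < (p + 1) ^ l := by positivity
    obtain ⟨w, rfl⟩ := Nat.exists_eq_add_of_le hvp
    have e1 : v + 2 + w - 2 = v + w := by omega
    rw [e1] at hAc
    rw [pow_succ] at hAb
    generalize (v + 2 + w + 1) ^ l = X at *
    nlinarith

section gen
variable {ι O K V : Type} [Field K] [AddCommGroup V] [Module K V] [LinearOrder O]

def Std (K : Type) {ι O V : Type} [Field K] [AddCommGroup V] [Module K V] [LinearOrder O]
    (κ : ι → O) (v : ι → V) (a : ι) : Prop :=
  v a ∉ Submodule.span K (v '' {b | κ b < κ a})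

lemma std_indep (κ : ι → O) (hκ : Function.Injective κ) (v : ι → V) (T : Finset ι) :
    (∀ a ∈ T, Std K κ v a) → LinearIndepOn K v (T : Set ι) := by
  classical
  induction T using Finset.induction_on_max_value κ with
  | empty => intro _; simp
  | insert a s has hmax ih =>
    intro h
    rw [coe_insert, linearIndepOn_insert (by simpa using has)]
    refine ⟨ih fun b hb => h b (mem_insert_of_mem hb), fun hmem => h a (mem_insert_self _ _) ?_⟩
    refine Submodule.span_mono (Set.image_mono ?_) hmem
    intro b hb
    exact lt_of_le_of_ne (hmax b hb) (fun e => has (hκ e ▸ hb))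

lemma std_span [WellFoundedLT O] (κ : ι → O) (v : ι → V) (T : Set ι)
    (hT : ∀ a ∈ T, ∀ b, κ b < κ a → b ∈ T) (a : ι) (ha : a ∈ T) :
    v a ∈ Submodule.span K (v '' {a | a ∈ T ∧ Std K κ v a}) := by
  induction h : κ a using WellFoundedLT.induction generalizing a with
  | ind o ih =>
    subst h
    by_cases hs : Std K κ v a
    · exact Submodule.subset_span ⟨a, ⟨ha, hs⟩, rfl⟩
    · rw [Std, not_not] at hs
      refine (Submodule.span_le.2 ?_) hs
      rintro _ ⟨b, hb, rfl⟩
      exact ih _ hb b (hT a ha b hb) rfl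

lemma std_finrank [WellFoundedLT O] (κ : ι → O) (hκ : Function.Injective κ) (v : ι → V) (T : Set ι)
    (hT : ∀ a ∈ T, ∀ b, κ b < κ a → b ∈ T) (B : Finset ι)
    (hB : ∀ a, a ∈ B ↔ a ∈ T ∧ Std K κ v a) :
    Module.finrank K (Submodule.span K (v '' T)) = B.card := by
  have e : Submodule.span K (v '' T) = Submodule.span K (v '' (B : Set ι)) := by
    have hBs : (B : Set ι) = {a | a ∈ T ∧ Std K κ v a} := by ext a; exact hB a
    rw [hBs]
    apply le_antisymm
    · rw [Submodule.span_le]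
      rintro _ ⟨a, ha, rfl⟩
      exact std_span κ v T hT a ha
    · exact Submodule.span_mono (Set.image_mono fun a ha => ha.1)
  rw [e]
  have hi := std_indep (K := K) κ hκ v B (fun a ha => ((hB a).1 ha).2)
  have := finrank_span_eq_card (R := K) (b := fun x : (B : Set ι) => v x) hi
  rw [← Set.image_eq_range] at this
  simpa using this

end gen

/-- graded lexicographic key -/
def gkey {m : ℕ} (a : Fin m → ℕ) : ℕ ×ₗ Lex (Fin m → ℕ) := toLex (∑ i, a i, toLex a)

lemma gkey_inj {m : ℕ} : Function.Injective (gkey (m := m)) := by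
  intro a b h
  have := congrArg (fun x => (ofLex x).2) h
  exact this

lemma gkey_lt {m : ℕ} (a b : Fin m → ℕ) : gkey a < gkey b ↔
    (∑ i, a i < ∑ i, b i ∨ (∑ i, a i = ∑ i, b i ∧ ∃ i, (∀ j < i, a j = b j) ∧ a i < b i)) := by
  rw [gkey, gkey, Prod.Lex.toLex_lt_toLex]
  exact Iff.rfl

lemma gkey_add {m : ℕ} (a b c : Fin m → ℕ) (h : gkey a < gkey b) : gkey (a + c) < gkey (b + c) := by
  rw [gkey_lt] at *
  simp only [Pi.add_apply, sum_add_distrib]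
  rcases h with h | ⟨h, i, h1, h2⟩
  · left; omega
  · right; exact ⟨by omega, i, fun j hj => by rw [h1 j hj], by omega⟩

lemma gkey_deg {m : ℕ} (a b : Fin m → ℕ) (h : gkey a < gkey b) : ∑ i, a i ≤ ∑ i, b i := by
  rw [gkey_lt] at h; omega

section mon
variable {F : Type} [Field F] {m : ℕ}

/-- monomial function on `S` -/
def mono (S : Finset (Fin m → F)) (a : Fin m → ℕ) : S → F := fun x => ∏ i, x.1 i ^ a i

abbrev St (S : Finset (Fin m → F)) (a : Fin m → ℕ) : Prop := Std F gkey (mono S) a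

lemma mono_add (S : Finset (Fin m → F)) (a b : Fin m → ℕ) :
    mono S (a + b) = mono S a * mono S b := by
  ext x; simp [mono, pow_add, prod_mul_distrib]

lemma st_down (S : Finset (Fin m → F)) (a b : Fin m → ℕ) (h : St S a) (hb : b ≤ a) : St S b := by
  intro hmem
  apply h
  obtain ⟨c, rfl⟩ : ∃ c, a = b + c := ⟨a - b, by ext i; have h1 : b i ≤ a i := hb i; simp; omega⟩
  rw [mono_add, mul_comm]
  have := Submodule.mem_map_of_mem (f := LinearMap.mulLeft F (mono S c)) hmem
  rw [Submodule.map_span] at this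
  rw [LinearMap.mulLeft_apply] at this
  refine Submodule.span_mono ?_ this
  rintro _ ⟨_, ⟨d, hd, rfl⟩, rfl⟩
  refine ⟨d + c, gkey_add _ _ _ hd, ?_⟩
  rw [mono_add, LinearMap.mulLeft_apply, mul_comm]

lemma st_box [Fintype F] (S : Finset (Fin m → F)) (a : Fin m → ℕ) (h : St S a) (i : Fin m) :
    a i ≤ Fintype.card F - 1 := by
  by_contra hc
  have hq : 1 < Fintype.card F := Fintype.one_lt_card
  have : St S (Pi.single i (Fintype.card F)) := by
    apply st_down S a _ h
    intro j
    by_cases hj : j = i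
    · subst hj; simp; omega
    · simp [hj]
  apply this
  apply Submodule.subset_span
  refine ⟨Pi.single i 1, ?_, ?_⟩
  · rw [Set.mem_ofPred_eq, gkey_lt]; left; simp [hq]
  · have hp : ∀ n : ℕ, ∀ x : S, mono S (Pi.single i n) x = x.1 i ^ n := by
      intro n x
      rw [mono, Finset.prod_eq_single i]
      · simp
      · intro j _ hj; simp [hj]
      · simp
    ext x
    rw [hp, hp, FiniteField.pow_card, pow_one]

lemma eval_mem_span (S : Finset (Fin m → F)) (P : MvPolynomial (Fin m) F) :
    (fun x : S => MvPolynomial.eval x.1 P) ∈ Submodule.span F (mono S '' Set.univ) := by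
  have : (fun x : S => MvPolynomial.eval x.1 P) = ∑ d ∈ P.support, P.coeff d • mono S d := by
    ext x
    rw [MvPolynomial.eval_eq']
    simp [mono]
  rw [this]
  exact Submodule.sum_mem _ fun d _ => Submodule.smul_mem _ _ (Submodule.subset_span ⟨d, trivial, rfl⟩)

lemma span_univ [Fintype F] (S : Finset (Fin m → F)) :
    Submodule.span F (mono S '' Set.univ) = ⊤ := by
  classical
  rw [eq_top_iff]
  rintro g -
  have h := MvPolynomial.map_restrict_dom_evalₗ F (Fin m)
  have hm : (fun x => if hx : x ∈ S then g ⟨x, hx⟩ else 0 : (Fin m → F) → F) ∈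
    (⊤ : Submodule F ((Fin m → F) → F)) := trivial
  rw [← h] at hm
  obtain ⟨P, -, hP⟩ := hm
  have := eval_mem_span S P
  convert this using 1
  ext x
  have := congrFun hP x.1
  rw [MvPolynomial.evalₗ_apply] at this
  rw [this]; simp

/-- functions of degree at most d on S -/
def Vd (S : Finset (Fin m → F)) (d : ℕ) : Submodule F (S → F) :=
  Submodule.span F (mono S '' {a | ∑ i, a i ≤ d})

lemma pairing [Fintype F] (S : Finset (Fin m → F)) (P : MvPolynomial (Fin m) F)
    (hS : ∀ x, x ∈ S ↔ MvPolynomial.eval x P ≠ 0) (i j : ℕ)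
    (hd : P.totalDegree + i + j < m * (Fintype.card F - 1)) :
    Module.finrank F (Vd S i) + Module.finrank F (Vd S j) ≤ S.card := by
  classical
  let L : (S → F) →ₗ[F] Module.Dual F (S → F) :=
    LinearMap.mk₂ F (fun g h => ∑ x : S, MvPolynomial.eval x.1 P * g x * h x)
      (by intro a b c; simp only [Pi.add_apply, mul_add, add_mul, sum_add_distrib])
      (by intro a b c; simp only [Pi.smul_apply, smul_eq_mul, mul_sum]
          exact sum_congr rfl fun x _ => by ring)
      (by intro a b c; simp only [Pi.add_apply, mul_add, sum_add_distrib])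
      (by intro a b c; simp only [Pi.smul_apply, smul_eq_mul, mul_sum]
          exact sum_congr rfl fun x _ => by ring)
  have hL : ∀ g h, L g h = ∑ x : S, MvPolynomial.eval x.1 P * g x * h x := fun _ _ => rfl
  have hinj : Function.Injective L := by
    rw [← LinearMap.ker_eq_bot, LinearMap.ker_eq_bot']
    intro g hg
    ext x
    have := hL g (Pi.single x 1)
    rw [hg] at this
    simp [Pi.single_apply] at this
    rcases this with h | h
    · exact absurd h ((hS x.1).1 x.2)
    · simpa using h
  have hle : (Vd S i).map L ≤ (Vd S j).dualAnnihilator := by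
    rw [Vd, Submodule.map_span, Submodule.span_le]
    rintro _ ⟨_, ⟨a, ha, rfl⟩, rfl⟩
    rw [SetLike.mem_coe, Submodule.mem_dualAnnihilator]
    intro w hw
    rw [Vd] at hw
    induction hw using Submodule.span_induction with
    | mem x hx =>
      obtain ⟨b, hb, rfl⟩ := hx
      rw [hL]
      let M : (Fin m → ℕ) → MvPolynomial (Fin m) F := fun a => ∏ i, MvPolynomial.X i ^ a i
      have hMd : ∀ a, (M a).totalDegree ≤ ∑ i, a i := by
        intro a
        refine (MvPolynomial.totalDegree_finsetProd _ _).trans (sum_le_sum fun i _ => ?_)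
        rw [MvPolynomial.totalDegree_X_pow]
      have hMe : ∀ a x, MvPolynomial.eval x (M a) = ∏ i, x i ^ a i := by
        intro a x; simp [M, map_prod]
      have h0 := MvPolynomial.sum_eval_eq_zero (P * M a * M b) (by
        have h1 := MvPolynomial.totalDegree_mul (P * M a) (M b)
        have h2 := MvPolynomial.totalDegree_mul P (M a)
        have h3 := hMd a
        have h4 := hMd b
        simp only [Set.mem_ofPred_eq] at ha hb
        rw [Fintype.card_fin, mul_comm (_ - 1)]
        omega)
      rw [← h0]
      simp only [map_mul, hMe, mono]
      rw [Finset.sum_coe_sort S (fun x => MvPolynomial.eval x P * (∏ i, x i ^ a i) * ∏ i, x i ^ b i)]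
      apply Finset.sum_subset (subset_univ _)
      intro x _ hx
      rw [hS, not_not] at hx
      rw [hx]; ring
    | zero => simp
    | add x y _ _ hx hy => rw [map_add, hx, hy, add_zero]
    | smul c x _ hx => rw [map_smul, hx, smul_zero]
  have h1 := Submodule.finrank_mono hle
  rw [(Submodule.equivMapOfInjective L hinj (Vd S i)).symm.finrank_eq] at h1
  have h2 := Subspace.finrank_add_finrank_dualAnnihilator_eq (Vd S j)
  rw [Module.finrank_fintype_fun_eq_card, Fintype.card_coe] at h2
  omega

lemma hyper (S : Finset (Fin m → F)) (i : Fin m) (h : ¬ St S (Pi.single i 1)) :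
    ∃ (φ : (Fin m → F) →ₗ[F] F) (c : F), φ ≠ 0 ∧ ∀ x ∈ S, φ x = c := by
  have hmem : mono S (Pi.single i 1) ∈
      Submodule.span F (mono S '' {b | gkey b < gkey (Pi.single i 1)}) := by
    by_contra hc; exact h hc
  have hp : ∀ j : Fin m, ∀ x : S, mono S (Pi.single j 1) x = x.1 j := by
    intro i x
    rw [mono, Finset.prod_eq_single i]
    · simp
    · intro j _ hj; simp [hj]
    · simp
  have key : ∀ g ∈ Submodule.span F (mono S '' {b | gkey b < gkey (Pi.single i 1)}),
      ∃ (φ : (Fin m → F) →ₗ[F] F) (c : F), φ (Pi.single i 1) = 0 ∧ ∀ x : S, g x = φ x.1 + c := by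
    intro g hg
    induction hg using Submodule.span_induction with
    | mem x hx =>
      obtain ⟨b, hb, rfl⟩ := hx
      have hd := gkey_deg _ _ hb
      rw [Finset.sum_pi_single'] at hd
      simp only [mem_univ, if_true] at hd
      by_cases hb0 : b = 0
      · subst hb0
        exact ⟨0, 1, rfl, fun x => by simp [mono]⟩
      · obtain ⟨j, hj⟩ : ∃ j, b j ≠ 0 := by
          by_contra hc; push Not at hc; exact hb0 (funext hc)
        have hbj : b = Pi.single j 1 := by
          have s1 := Finset.add_sum_erase univ b (mem_univ j)
          have s2 : ∑ k ∈ univ.erase j, b k = 0 := by omega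
          rw [Finset.sum_eq_zero_iff] at s2
          ext k
          by_cases hk : k = j
          · subst hk; simp; omega
          · rw [s2 k (by simp [hk])]; simp [hk]
        subst hbj
        have hji : j ≠ i := by rintro rfl; rw [Set.mem_ofPred_eq] at hb; exact lt_irrefl _ hb
        refine ⟨LinearMap.proj j, 0, ?_, fun x => ?_⟩
        · simp [hji]
        · rw [hp]; simp
    | zero => exact ⟨0, 0, rfl, fun x => by simp⟩
    | add x y _ _ hx hy =>
      obtain ⟨φ, c, h1, h2⟩ := hx
      obtain ⟨ψ, d, h3, h4⟩ := hy
      refine ⟨φ + ψ, c + d, by simp [h1, h3], fun z => ?_⟩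
      simp [h2, h4]; ring
    | smul c x _ hx =>
      obtain ⟨φ, d, h1, h2⟩ := hx
      refine ⟨c • φ, c * d, by simp [h1], fun z => ?_⟩
      simp [h2]; ring
  obtain ⟨φ, c, h1, h2⟩ := key _ hmem
  refine ⟨LinearMap.proj i - φ, c, ?_, ?_⟩
  · intro h0
    have := LinearMap.congr_fun h0 (Pi.single i 1)
    simp [h1] at this
  · intro x hx
    have := h2 ⟨x, hx⟩
    rw [hp] at this
    simp at this
    simp [this]
end mon

end helpers

open Finset in
/-- A second weight codeword of `R_q(t(q-1)+s, m)`, `1 ≤ t ≤ m-2`, `2 ≤ s ≤ q-2`,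
has its support contained in an affine hyperplane. -/
theorem stmt11 {F : Type} [Field F] [Fintype F] [DecidableEq F] {m t s : ℕ}
    (hq : 4 ≤ Fintype.card F) (hm : 3 ≤ m) (ht1 : 1 ≤ t) (ht2 : t ≤ m - 2)
    (hs1 : 2 ≤ s) (hs2 : s ≤ Fintype.card F - 2)
    (f : (Fin m → F) → F)
    (hf : RM F (t * (Fintype.card F - 1) + s) m f)
    (hw : wt f = (Fintype.card F - s + 1) * (Fintype.card F - 1) *
      Fintype.card F ^ (m - t - 2)) :
    ∃ (φ : (Fin m → F) →ₗ[F] F) (c : F), φ ≠ 0 ∧ ∀ x : Fin m → F, f x ≠ 0 → φ x = c := by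
  classical
  obtain ⟨P, hP, hPe⟩ := hf
  by_contra hcon
  let S : Finset (Fin m → F) := univ.filter fun x => f x ≠ 0
  have hSm : ∀ x, x ∈ S ↔ f x ≠ 0 := by intro x; simp [S]
  have hS : ∀ x, x ∈ S ↔ MvPolynomial.eval x P ≠ 0 := by intro x; rw [hSm, hPe]
  have hSc : S.card = wt f := rfl
  have hst : ∀ i, St S (Pi.single i 1) := by
    intro i
    by_contra h
    obtain ⟨φ, c, h1, h2⟩ := hyper S i h
    exact hcon ⟨φ, c, h1, fun x hx => h2 x ((hSm x).2 hx)⟩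
  let Δ : Finset (Fin m → ℕ) :=
    (Fintype.piFinset fun _ => Finset.range (Fintype.card F)).filter fun a => St S a
  have hΔ : ∀ a, a ∈ Δ ↔ St S a := by
    intro a
    simp only [Δ, mem_filter, Fintype.mem_piFinset, mem_range]
    refine ⟨fun h => h.2, fun h => ⟨fun i => ?_, h⟩⟩
    have := st_box S a h i
    omega
  have hΔc : Δ.card = S.card := by
    have h1 := std_finrank (K := F) gkey gkey_inj (mono S) Set.univ (fun _ _ _ _ => trivial) Δ
      (fun a => by rw [hΔ]; simp)
    rw [span_univ, finrank_top, Module.finrank_fintype_fun_eq_card, Fintype.card_coe] at h1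
    exact h1.symm
  have hV : ∀ d, Module.finrank F (Vd S d) = (Δ.filter fun a => ∑ i, a i ≤ d).card := by
    intro d
    apply std_finrank (K := F) gkey gkey_inj (mono S)
    · intro a ha b hb
      exact (gkey_deg _ _ hb).trans ha
    · intro a
      rw [mem_filter, hΔ, and_comm]; rfl
  obtain ⟨p, hp⟩ : ∃ p, Fintype.card F = p + 1 := ⟨Fintype.card F - 1, by omega⟩
  obtain ⟨l, hl⟩ : ∃ l, m = l + t + 2 := ⟨m - t - 2, by omega⟩
  obtain ⟨v, hv⟩ : ∃ v, p = v + s := ⟨p - s, by omega⟩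
  have hmt : m - t - 2 = l := by omega
  have hq1 : Fintype.card F - 1 = p := by omega
  have hqs : Fintype.card F - s + 1 = v + 2 := by omega
  rw [hmt, hq1, hqs, hp] at hw
  rw [hq1] at hP
  have hmp : m * p = t * p + ((l + 1) * p + v) + s := by
    rw [hl]
    have : (l + t + 2) * p = t * p + (l + 1) * p + p := by ring
    omega
  have hlp : (l + 1) * p = l * p + p := by ring
  have hdown : ∀ a ∈ Δ, ∀ b ≤ a, b ∈ Δ := by
    intro a ha b hb
    rw [hΔ] at *
    exact st_down S a b ha hb
  have hsing : ∀ i, Pi.single i 1 ∈ Δ := fun i => (hΔ _).2 (hst i)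
  have h0 : (0 : Fin m → ℕ) ∈ Δ := hdown _ (hsing ⟨0, by omega⟩) _ (fun _ => Nat.zero_le _)
  refine comb p l v Δ (by omega) (by omega) (by omega) hdown
    (fun a ha i => by have := st_box S a ((hΔ a).1 ha) i; omega) (by rw [hΔc, hSc, hw]) ?_ ?_
  · have hpair := pairing S P hS 0 ((l + 1) * p + v - 1) (by rw [hq1]; omega)
    rw [hV, hV, ← hΔc] at hpair
    by_contra hc
    push Not at hc
    have e1 : (Δ.filter fun a => ∑ i, a i ≤ (l + 1) * p + v - 1) = Δ :=
      Finset.filter_true_of_mem fun a ha => by have := hc a ha; omega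
    have e2 : 0 < (Δ.filter fun a => ∑ i, a i ≤ 0).card :=
      Finset.card_pos.2 ⟨0, by simp [h0]⟩
    rw [e1] at hpair
    omega
  · have hpair := pairing S P hS 1 ((l + 1) * p + v - 2) (by rw [hq1]; omega)
    rw [hV, hV, ← hΔc] at hpair
    have e1 := Finset.card_filter_add_card_filter_not (s := Δ)
      (fun a : Fin m → ℕ => ∑ i, a i ≤ (l + 1) * p + v - 2)
    have e2 : (Δ.filter fun a : Fin m → ℕ => ¬ ∑ i, a i ≤ (l + 1) * p + v - 2) =
        Δ.filter fun a => (l + 1) * p + v ≤ ∑ i, a i + 1 :=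
      Finset.filter_congr fun a _ => by omega
    rw [e2] at e1
    have hinj : Function.Injective (fun i : Fin m => (Pi.single i 1 : Fin m → ℕ)) := by
      intro i j hij
      by_contra hne
      have := congrFun hij i
      simp [hne] at this
    have e3 : insert 0 (univ.image fun i : Fin m => (Pi.single i 1 : Fin m → ℕ)) ⊆
        Δ.filter fun a => ∑ i, a i ≤ 1 := by
      intro a ha
      rw [mem_insert, mem_image] at ha
      rw [mem_filter]
      rcases ha with rfl | ⟨i, -, rfl⟩
      · exact ⟨h0, by simp⟩
      · exact ⟨hsing i, by simp⟩
    have e4 := card_le_card e3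
    rw [card_insert_of_notMem (by
      rw [mem_image]
      rintro ⟨i, -, h⟩
      have := congrFun h i
      simp at this), card_image_of_injective _ hinj, card_univ, Fintype.card_fin] at e4
    omega
end
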